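/- arXiv:math/0204013 — 15 statements merged into one kernel-verified Lean document; each statement's English description precedes it below -/
import Mathlib

section
/- Fix an integer m ≥ 1. Let Q, Y, σ, τ, μ be continuously differentiable (C¹) real-valued functions of the real variable φ on an open interval I on which Q ≠ 0 everywhere and σ ≠ 0 everywhere, and suppose that on I they satisfy Q' = 2τ, Y' = −2μ, Qσ' = 2(τ−σ)σ, and Qτ' = 2(m−1)(σ−τ)σ − μQ. Then the functions φ ↦ 2φ − Q(φ)/σ(φ) and φ ↦ 2τ(φ) + 2(m−1)σ(φ) − Y(φ) are constant on I. -/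
open Set

/-- A function with vanishing derivative on an open interval is constant there. -/
theorem exists_eq_const_of_hasDerivAt_zero {p q : ℝ} (hpq : p < q) {f : ℝ → ℝ}
    (hf : ∀ x ∈ Ioo p q, HasDerivAt f 0 x) : ∃ k : ℝ, ∀ x ∈ Ioo p q, f x = k := by
  obtain ⟨c, hc⟩ := nonempty_Ioo.2 hpq
  exact ⟨f c, fun x hx => isOpen_Ioo.is_const_of_deriv_eq_zero isPreconnected_Ioo
    (fun y hy => (hf y hy).differentiableAt.differentiableWithinAt)
    (fun y hy => (hf y hy).deriv) hx hc⟩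

/-- A `C¹` function on an open interval has its derivative at each point of the interval. -/
theorem ContDiffOn.hasDerivAt_of_mem_Ioo {p q x : ℝ} {f : ℝ → ℝ}
    (hf : ContDiffOn ℝ 1 f (Ioo p q)) (hx : x ∈ Ioo p q) : HasDerivAt f (deriv f x) x :=
  ((hf.differentiableOn one_ne_zero).differentiableAt (isOpen_Ioo.mem_nhds hx)).hasDerivAt

/-- For an integer `m ≥ 1` and `C¹` functions `Q, Y, σ, τ, μ` on an open
interval on which `Q ≠ 0` and `σ ≠ 0` everywhere, satisfying the first four equations of
the system (10.1), the functions `2φ − Q/σ` and `2τ + 2(m−1)σ − Y` are constant. -/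
theorem stmt_0 (m : ℕ) (hm : 1 ≤ m) (p q : ℝ) (hpq : p < q)
    (Q Y σ τ μ : ℝ → ℝ)
    (hQ : ContDiffOn ℝ 1 Q (Ioo p q)) (hY : ContDiffOn ℝ 1 Y (Ioo p q))
    (hσ : ContDiffOn ℝ 1 σ (Ioo p q)) (hτ : ContDiffOn ℝ 1 τ (Ioo p q))
    (hμ : ContDiffOn ℝ 1 μ (Ioo p q))
    (hQ0 : ∀ x ∈ Ioo p q, Q x ≠ 0) (hσ0 : ∀ x ∈ Ioo p q, σ x ≠ 0)
    (h1 : ∀ x ∈ Ioo p q, deriv Q x = 2 * τ x)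
    (h2 : ∀ x ∈ Ioo p q, deriv Y x = -2 * μ x)
    (h3 : ∀ x ∈ Ioo p q, Q x * deriv σ x = 2 * (τ x - σ x) * σ x)
    (h4 : ∀ x ∈ Ioo p q,
      Q x * deriv τ x = 2 * ((m : ℝ) - 1) * (σ x - τ x) * σ x - μ x * Q x) :
    (∃ k : ℝ, ∀ x ∈ Ioo p q, 2 * x - Q x / σ x = k) ∧
    (∃ k : ℝ, ∀ x ∈ Ioo p q, 2 * τ x + 2 * ((m : ℝ) - 1) * σ x - Y x = k) := by
  constructor
  · refine exists_eq_const_of_hasDerivAt_zero hpq fun x hx => ?_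
    have hx0 := hσ0 x hx
    refine (((hasDerivAt_id' x).const_mul 2).sub
      ((hQ.hasDerivAt_of_mem_Ioo hx).div (hσ.hasDerivAt_of_mem_Ioo hx) hx0)).congr_deriv ?_
    rw [h1 x hx, h3 x hx]
    field_simp
    ring
  · refine exists_eq_const_of_hasDerivAt_zero hpq fun x hx => ?_
    refine ((((hτ.hasDerivAt_of_mem_Ioo hx).const_mul 2).add
      ((hσ.hasDerivAt_of_mem_Ioo hx).const_mul (2 * ((m : ℝ) - 1)))).sub
      (hY.hasDerivAt_of_mem_Ioo hx)).congr_deriv ?_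
    apply mul_left_cancel₀ (hQ0 x hx)
    rw [h2 x hx]
    linear_combination 2 * h4 x hx + 2 * ((m : ℝ) - 1) * h3 x hx
end

section
/- Fix an integer m ≥ 2. Let Q, Y, s, σ, τ, λ, μ be continuously differentiable (C¹) real-valued functions of φ on an open interval I satisfying the system (10.1) and the equations (10.2) on I, with Q ≠ 0 everywhere on I. If σ(φ) ≠ τ(φ) for every φ ∈ I, then 2μ + 2(m−1)λ − s is constant on I. If λ(φ) ≠ μ(φ) for every φ ∈ I, then, setting Z = 2(m−1)(τ−σ)/(λ−μ), the function φ ↦ Z(φ) − φ is constant on I. -/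
open Set

/-- The ODE system (10.1). -/
def Sys101 (m : ℕ) (I : Set ℝ) (Q Y σ τ lm μ : ℝ → ℝ) : Prop :=
  ∀ x ∈ I,
    deriv Q x = 2 * τ x ∧
    deriv Y x = -2 * μ x ∧
    Q x * deriv σ x = 2 * (τ x - σ x) * σ x ∧
    Q x * deriv τ x = 2 * ((m : ℝ) - 1) * (σ x - τ x) * σ x - μ x * Q x ∧
    Q x * deriv lm x = 2 * (μ x - lm x) * σ x

/-- The equations (10.2). -/
def Eqs102 (m : ℕ) (I : Set ℝ) (Q s σ τ lm μ : ℝ → ℝ) : Prop :=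
  ∀ x ∈ I,
    2 * ((m : ℝ) - 1) * (τ x - σ x) * Q x * deriv μ x =
      (lm x - μ x) *
        (lm x * Q x + (2 * (m : ℝ) - 3) * μ x * Q x +
          4 * ((m : ℝ) - 1) ^ 2 * (τ x - σ x) * σ x) ∧
    ((m : ℝ) - 1) * (τ x - σ x) * deriv s x =
      (lm x - μ x) * (lm x + (2 * (m : ℝ) - 3) * μ x)

/-- A function with vanishing derivative on an open interval is constant there. -/
theorem exists_eq_const_on_Ioo {p q : ℝ} {f : ℝ → ℝ}
    (hf : ∀ x ∈ Ioo p q, HasDerivAt f 0 x) : ∃ k, ∀ x ∈ Ioo p q, f x = k :=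
  isOpen_Ioo.exists_is_const_of_deriv_eq_zero isPreconnected_Ioo
    (fun x hx => (hf x hx).differentiableAt.differentiableWithinAt)
    (fun x hx => (hf x hx).deriv)

theorem stmt_1 (m : ℕ) (hm : 2 ≤ m) (p q : ℝ) (hpq : p < q)
    (Q Y s σ τ lm μ : ℝ → ℝ)
    (hQ : ContDiffOn ℝ 1 Q (Ioo p q)) (hY : ContDiffOn ℝ 1 Y (Ioo p q))
    (hs : ContDiffOn ℝ 1 s (Ioo p q)) (hσ : ContDiffOn ℝ 1 σ (Ioo p q))
    (hτ : ContDiffOn ℝ 1 τ (Ioo p q)) (hlm : ContDiffOn ℝ 1 lm (Ioo p q))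
    (hμ : ContDiffOn ℝ 1 μ (Ioo p q))
    (hsys : Sys101 m (Ioo p q) Q Y σ τ lm μ)
    (heqs : Eqs102 m (Ioo p q) Q s σ τ lm μ)
    (hQ0 : ∀ x ∈ Ioo p q, Q x ≠ 0) :
    ((∀ x ∈ Ioo p q, σ x ≠ τ x) →
      ∃ k : ℝ, ∀ x ∈ Ioo p q, 2 * μ x + 2 * ((m : ℝ) - 1) * lm x - s x = k) ∧
    ((∀ x ∈ Ioo p q, lm x ≠ μ x) →
      ∃ k : ℝ, ∀ x ∈ Ioo p q,
        2 * ((m : ℝ) - 1) * (τ x - σ x) / (lm x - μ x) - x = k) := by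
  have hm0 : (m : ℝ) - 1 ≠ 0 := by
    have : (2 : ℝ) ≤ m := by exact_mod_cast hm
    linarith
  refine ⟨fun hne => exists_eq_const_on_Ioo fun x hx => ?_,
    fun hne => exists_eq_const_on_Ioo fun x hx => ?_⟩
  · obtain ⟨-, -, -, -, hlm'⟩ := hsys x hx
    obtain ⟨hμ', hs'⟩ := heqs x hx
    have hfactor : ((m : ℝ) - 1) * (τ x - σ x) * Q x ≠ 0 :=
      mul_ne_zero (mul_ne_zero hm0 (sub_ne_zero.2 (hne x hx).symm)) (hQ0 x hx)
    refine ((((hμ.hasDerivAt_of_mem_Ioo hx).const_mul 2).add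
      ((hlm.hasDerivAt_of_mem_Ioo hx).const_mul (2 * ((m : ℝ) - 1)))).sub
      (hs.hasDerivAt_of_mem_Ioo hx)).congr_deriv ?_
    refine mul_left_cancel₀ hfactor ?_
    linear_combination hμ' + 2 * ((m : ℝ) - 1) ^ 2 * (τ x - σ x) * hlm' - Q x * hs'
  · obtain ⟨-, -, hσ', hτ', hlm'⟩ := hsys x hx
    obtain ⟨hμ', -⟩ := heqs x hx
    have hL : lm x - μ x ≠ 0 := sub_ne_zero.2 (hne x hx)
    refine (((((hτ.hasDerivAt_of_mem_Ioo hx).sub (hσ.hasDerivAt_of_mem_Ioo hx)).const_mul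
      (2 * ((m : ℝ) - 1))).div ((hlm.hasDerivAt_of_mem_Ioo hx).sub
      (hμ.hasDerivAt_of_mem_Ioo hx)) hL).sub (hasDerivAt_id x)).congr_deriv ?_
    simp only [Pi.sub_apply]
    rw [sub_eq_zero, div_eq_one_iff_eq (pow_ne_zero 2 hL)]
    refine mul_left_cancel₀ (hQ0 x hx) ?_
    linear_combination 2 * ((m : ℝ) - 1) * (lm x - μ x) * (hτ' - hσ')
      - 2 * ((m : ℝ) - 1) * (τ x - σ x) * hlm' + hμ'
end

section
/- Fix an integer m ≥ 1. Let Q, Y, s, σ, τ, λ, μ be continuously differentiable (C¹) real-valued functions of φ on an open interval I satisfying the system (10.1) and the constraints (10.3) on I. Then the equations (10.2) hold on I. -/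
open Set

/-- The constraints (10.3). -/
def Con103 (m : ℕ) (I : Set ℝ) (Q Y s σ τ lm μ : ℝ → ℝ) : Prop :=
  (∀ x ∈ I, Q x ≠ 0) ∧
  (∀ x ∈ I, Y x = 2 * τ x + 2 * ((m : ℝ) - 1) * σ x ∧
    s x = 2 * μ x + 2 * ((m : ℝ) - 1) * lm x) ∧
  (∀ x ∈ I, 2 * ((m : ℝ) - 1) * (τ x - σ x) = (lm x - μ x) * x)

/-- (10.1) together with the constraints (10.3) imply the equations (10.2). -/
theorem stmt_2 (m : ℕ) (hm : 1 ≤ m) (p q : ℝ) (hpq : p < q)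
    (Q Y s σ τ lm μ : ℝ → ℝ)
    (hQ : ContDiffOn ℝ 1 Q (Ioo p q)) (hY : ContDiffOn ℝ 1 Y (Ioo p q))
    (hs : ContDiffOn ℝ 1 s (Ioo p q)) (hσ : ContDiffOn ℝ 1 σ (Ioo p q))
    (hτ : ContDiffOn ℝ 1 τ (Ioo p q)) (hlm : ContDiffOn ℝ 1 lm (Ioo p q))
    (hμ : ContDiffOn ℝ 1 μ (Ioo p q))
    (hsys : Sys101 m (Ioo p q) Q Y σ τ lm μ)
    (hcon : Con103 m (Ioo p q) Q Y s σ τ lm μ) :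
    Eqs102 m (Ioo p q) Q s σ τ lm μ := by
  intro x hx
  have hnhds : Ioo p q ∈ nhds x := Ioo_mem_nhds hx.1 hx.2
  have hasDeriv : ∀ f : ℝ → ℝ, ContDiffOn ℝ 1 f (Ioo p q) → HasDerivAt f (deriv f x) x :=
    fun f hf => ((hf.differentiableOn one_ne_zero).differentiableAt hnhds).hasDerivAt
  obtain ⟨-, -, eσ, eτ, elm⟩ := hsys x hx
  obtain ⟨hQ0, hYs, hφ⟩ := hcon
  have key : 2 * ((m : ℝ) - 1) * (deriv τ x - deriv σ x) =
      (deriv lm x - deriv μ x) * x + (lm x - μ x) * 1 :=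
    (((hasDeriv τ hτ).sub (hasDeriv σ hσ)).const_mul (2 * ((m : ℝ) - 1))).unique
      ((((hasDeriv lm hlm).sub (hasDeriv μ hμ)).mul (hasDerivAt_id x)).congr_of_eventuallyEq
        (Filter.eventually_of_mem hnhds hφ))
  have es : deriv s x = 2 * deriv μ x + 2 * ((m : ℝ) - 1) * deriv lm x :=
    ((((hasDeriv μ hμ).const_mul 2).add
      ((hasDeriv lm hlm).const_mul (2 * ((m : ℝ) - 1)))).congr_of_eventuallyEq
        (Filter.eventually_of_mem hnhds fun y hy => (hYs y hy).2)).deriv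
  have hx' := hφ x hx
  have eμ : Q x * deriv μ x * x = lm x * Q x + (2 * (m : ℝ) - 3) * μ x * Q x +
      4 * ((m : ℝ) - 1) ^ 2 * (τ x - σ x) * σ x := by
    linear_combination Q x * key + x * elm - 2 * ((m : ℝ) - 1) * (eτ - eσ) + 2 * σ x * hx'
  have first : 2 * ((m : ℝ) - 1) * (τ x - σ x) * Q x * deriv μ x =
      (lm x - μ x) *
        (lm x * Q x + (2 * (m : ℝ) - 3) * μ x * Q x +
          4 * ((m : ℝ) - 1) ^ 2 * (τ x - σ x) * σ x) := by
    linear_combination (lm x - μ x) * eμ + Q x * deriv μ x * hx'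
  refine ⟨first, mul_left_cancel₀ (hQ0 x hx) ?_⟩
  linear_combination first + Q x * ((m : ℝ) - 1) * (τ x - σ x) * es +
    2 * ((m : ℝ) - 1) ^ 2 * (τ x - σ x) * elm
end

section
/- Fix an integer m ≥ 1. Let Q, Y, s, σ, τ, λ, μ be continuously differentiable (C¹) real-valued functions of φ on an open interval I satisfying the system (10.1) and the constraints (10.3) on I, with σ ≠ 0 everywhere on I, and let c be a real constant such that Q = 2(φ−c)σ on I. Then σ is twice differentiable on I and, on I: τ = σ + (φ−c)σ', Y = 2mσ + 2(φ−c)σ', μ = −(m+1)σ' − (φ−c)σ'', and (λ−μ)φ = 2(m−1)(φ−c)σ'. -/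
open Set

theorem stmt_4 (m : ℕ) (hm : 1 ≤ m) (p q : ℝ) (hpq : p < q)
    (Q Y s σ τ lm μ : ℝ → ℝ)
    (hQ : ContDiffOn ℝ 1 Q (Ioo p q)) (hY : ContDiffOn ℝ 1 Y (Ioo p q))
    (hs : ContDiffOn ℝ 1 s (Ioo p q)) (hσ : ContDiffOn ℝ 1 σ (Ioo p q))
    (hτ : ContDiffOn ℝ 1 τ (Ioo p q)) (hlm : ContDiffOn ℝ 1 lm (Ioo p q))
    (hμ : ContDiffOn ℝ 1 μ (Ioo p q))
    (hsys : Sys101 m (Ioo p q) Q Y σ τ lm μ)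
    (hcon : Con103 m (Ioo p q) Q Y s σ τ lm μ)
    (hσ0 : ∀ x ∈ Ioo p q, σ x ≠ 0)
    (c : ℝ) (hc : ∀ x ∈ Ioo p q, Q x = 2 * (x - c) * σ x) :
    ∀ x ∈ Ioo p q,
      DifferentiableAt ℝ σ x ∧ DifferentiableAt ℝ (deriv σ) x ∧
      τ x = σ x + (x - c) * deriv σ x ∧
      Y x = 2 * (m : ℝ) * σ x + 2 * (x - c) * deriv σ x ∧
      μ x = -((m : ℝ) + 1) * deriv σ x - (x - c) * deriv (deriv σ) x ∧
      (lm x - μ x) * x = 2 * ((m : ℝ) - 1) * (x - c) * deriv σ x := by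
  have hxc : ∀ x ∈ Ioo p q, x - c ≠ 0 := fun x hx h =>
    hcon.1 x hx (by rw [hc x hx, h]; ring)
  have hdiff : ∀ {f : ℝ → ℝ}, ContDiffOn ℝ 1 f (Ioo p q) → ∀ x ∈ Ioo p q,
      DifferentiableAt ℝ f x := fun hf x hx =>
    (hf.differentiableOn one_ne_zero).differentiableAt (isOpen_Ioo.mem_nhds hx)
  have hτσ : ∀ x ∈ Ioo p q, τ x = σ x + (x - c) * deriv σ x := by
    intro x hx
    have h := (hsys x hx).2.2.1
    rw [hc x hx] at h
    apply mul_left_cancel₀ (hσ0 x hx)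
    linarith
  intro x hx
  have hdσ := hdiff hσ x hx
  have hsub : DifferentiableAt ℝ (fun y : ℝ => y - c) x := by fun_prop
  have hσ' : DifferentiableAt ℝ (deriv σ) x := by
    refine (((hdiff hτ x hx).sub hdσ).div hsub (hxc x hx)).congr_of_eventuallyEq ?_
    filter_upwards [isOpen_Ioo.mem_nhds hx] with y hy
    simp [hτσ y hy, hxc y hy]
  have hτ' : deriv τ x = 2 * deriv σ x + (x - c) * deriv (deriv σ) x := by
    have hE : τ =ᶠ[nhds x] fun y => σ y + (y - c) * deriv σ y := by
      filter_upwards [isOpen_Ioo.mem_nhds hx] with y hy using hτσ y hy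
    refine hE.deriv_eq.trans ((hdσ.hasDerivAt.add
      (((hasDerivAt_id' x).sub_const c).mul hσ'.hasDerivAt)).deriv.trans ?_)
    ring
  have hμσ : μ x = -((m : ℝ) + 1) * deriv σ x - (x - c) * deriv (deriv σ) x := by
    have h := (hsys x hx).2.2.2.1
    rw [hc x hx, hτσ x hx, hτ'] at h
    apply mul_left_cancel₀ (mul_ne_zero (hxc x hx) (hσ0 x hx))
    linarith
  refine ⟨hdσ, hσ', hτσ x hx, ?_, hμσ, ?_⟩
  · rw [(hcon.2.1 x hx).1, hτσ x hx]
    ring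
  · rw [← hcon.2.2 x hx, hτσ x hx]
    ring
end

section
/- Fix an integer m ≥ 2. Let Q, Y, s, σ, τ, λ, μ be continuously differentiable (C¹) real-valued functions of φ on an open interval I satisfying the system (10.1), the equations (10.2) and the constraints (10.3) on I, with σ ≠ 0 everywhere on I, and let c be a real constant with Q = 2(φ−c)σ on I. Then σ is three times differentiable on I and satisfies, everywhere on I, φ²(φ−c)σ''' = ((m−4)φ² − 2(m−1)cφ)σ'' + 2(m−1)(φ+c)σ'. -/
open Set

/-- A function that agrees on an open set with `g / (x - c)`, for a differentiable `g`, is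
differentiable there, and the product rule applies to `(x - c) * f x = g x`. -/
lemma differentiableAt_of_sub_mul_eq {f g : ℝ → ℝ} {U : Set ℝ} {c x : ℝ} (hU : IsOpen U)
    (hx : x ∈ U) (hne : ∀ y ∈ U, y - c ≠ 0) (hg : DifferentiableAt ℝ g x)
    (h : ∀ y ∈ U, (y - c) * f y = g y) :
    DifferentiableAt ℝ f x ∧ f x + (x - c) * deriv f x = deriv g x := by
  have hfg : f =ᶠ[nhds x] fun y => g y / (y - c) := by
    filter_upwards [hU.mem_nhds hx] with y hy
    rw [← h y hy, mul_div_cancel_left₀ _ (hne y hy)]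
  have hf : DifferentiableAt ℝ f x :=
    (hg.div (differentiableAt_id.sub_const c) (hne x hx)).congr_of_eventuallyEq hfg
  have hgf : g =ᶠ[nhds x] fun y => (y - c) * f y := by
    filter_upwards [hU.mem_nhds hx] with y hy using (h y hy).symm
  refine ⟨hf, ?_⟩
  rw [hgf.deriv_eq, (((hasDerivAt_id' x).sub_const c).fun_mul hf.hasDerivAt).deriv, one_mul]

/-- The third-order equation (20.2) for `σ`. -/
theorem stmt_5 (m : ℕ) (hm : 2 ≤ m) (p q : ℝ) (hpq : p < q)
    (Q Y s σ τ lm μ : ℝ → ℝ)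
    (hQ : ContDiffOn ℝ 1 Q (Ioo p q)) (hY : ContDiffOn ℝ 1 Y (Ioo p q))
    (hs : ContDiffOn ℝ 1 s (Ioo p q)) (hσ : ContDiffOn ℝ 1 σ (Ioo p q))
    (hτ : ContDiffOn ℝ 1 τ (Ioo p q)) (hlm : ContDiffOn ℝ 1 lm (Ioo p q))
    (hμ : ContDiffOn ℝ 1 μ (Ioo p q))
    (hsys : Sys101 m (Ioo p q) Q Y σ τ lm μ)
    (heqs : Eqs102 m (Ioo p q) Q s σ τ lm μ)
    (hcon : Con103 m (Ioo p q) Q Y s σ τ lm μ)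
    (hσ0 : ∀ x ∈ Ioo p q, σ x ≠ 0)
    (c : ℝ) (hc : ∀ x ∈ Ioo p q, Q x = 2 * (x - c) * σ x) :
    ∀ x ∈ Ioo p q,
      DifferentiableAt ℝ σ x ∧ DifferentiableAt ℝ (deriv σ) x ∧
      DifferentiableAt ℝ (deriv (deriv σ)) x ∧
      x ^ 2 * (x - c) * deriv (deriv (deriv σ)) x =
        (((m : ℝ) - 4) * x ^ 2 - 2 * ((m : ℝ) - 1) * c * x) * deriv (deriv σ) x +
          2 * ((m : ℝ) - 1) * (x + c) * deriv σ x := by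
  have hd {f : ℝ → ℝ} (hf : ContDiffOn ℝ 1 f (Ioo p q)) {x : ℝ} (hx : x ∈ Ioo p q) :
      DifferentiableAt ℝ f x :=
    (hf.differentiableOn one_ne_zero).differentiableAt (isOpen_Ioo.mem_nhds hx)
  obtain ⟨hQ0, -, h3⟩ := hcon
  have hne : ∀ x ∈ Ioo p q, x - c ≠ 0 := fun x hx h0 => hQ0 x hx (by simp [hc x hx, h0])
  have h1 : ∀ x ∈ Ioo p q, (x - c) * deriv σ x = τ x - σ x := fun x hx => by
    have h := (hsys x hx).2.2.1
    rw [hc x hx] at h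
    refine mul_right_cancel₀ (hσ0 x hx) ?_
    linear_combination h / 2
  have hτ' : ∀ x ∈ Ioo p q, deriv τ x = -((m : ℝ) - 1) * deriv σ x - μ x := fun x hx => by
    have h := (hsys x hx).2.2.2.1
    rw [hc x hx] at h
    refine mul_left_cancel₀ (mul_ne_zero (hne x hx) (hσ0 x hx)) ?_
    linear_combination h / 2 + ((m : ℝ) - 1) * σ x * h1 x hx
  have hlm' : ∀ x ∈ Ioo p q, (x - c) * deriv lm x = μ x - lm x := fun x hx => by
    have h := (hsys x hx).2.2.2.2
    rw [hc x hx] at h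
    refine mul_right_cancel₀ (hσ0 x hx) ?_
    linear_combination h / 2
  have hD1 x (hx : x ∈ Ioo p q) := differentiableAt_of_sub_mul_eq isOpen_Ioo hx hne
    ((hd hτ hx).fun_sub (hd hσ hx)) h1
  have h2 : ∀ x ∈ Ioo p q,
      (x - c) * deriv (deriv σ) x = -μ x - ((m : ℝ) + 1) * deriv σ x := fun x hx => by
    have h := (hD1 x hx).2
    rw [deriv_fun_sub (hd hτ hx) (hd hσ hx)] at h
    linear_combination h + hτ' x hx
  intro x hx
  have hσ2 := (hD1 x hx).1
  obtain ⟨hσ3, h4⟩ := differentiableAt_of_sub_mul_eq isOpen_Ioo hx hne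
    ((hd hμ hx).fun_neg.fun_sub (hσ2.const_mul ((m : ℝ) + 1))) h2
  rw [deriv_fun_sub (hd hμ hx).fun_neg (hσ2.const_mul _), deriv.fun_neg,
    deriv_const_mul _ hσ2] at h4
  refine ⟨hd hσ hx, hσ2, hσ3, ?_⟩
  have h5 : 2 * ((m : ℝ) - 1) * (deriv τ x - deriv σ x) =
      (deriv lm x - deriv μ x) * x + (lm x - μ x) := by
    have heq : (fun y => 2 * ((m : ℝ) - 1) * (τ y - σ y)) =ᶠ[nhds x]
        fun y => (lm y - μ y) * y := by
      filter_upwards [isOpen_Ioo.mem_nhds hx] with y hy using h3 y hy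
    have hl := (((hd hτ hx).hasDerivAt.fun_sub (hd hσ hx).hasDerivAt).const_mul
      (2 * ((m : ℝ) - 1))).deriv
    have hr := (((hd hlm hx).hasDerivAt.fun_sub (hd hμ hx).hasDerivAt).fun_mul
      (hasDerivAt_id' x)).deriv
    rw [← hl, heq.deriv_eq, hr, mul_one]
  have h6 : 2 * ((m : ℝ) - 1) * deriv σ x = -x * deriv lm x := by
    refine mul_left_cancel₀ (hne x hx) ?_
    linear_combination 2 * ((m : ℝ) - 1) * h1 x hx + h3 x hx + x * hlm' x hx
  linear_combination x ^ 2 * h4 - x * h5 + 2 * ((m : ℝ) - 1) * x * (hτ' x hx - h2 x hx)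
    - x * h6 + h3 x hx + 2 * ((m : ℝ) - 1) * h1 x hx
end

section
/- Fix an integer m ≥ 2, a real number c, and an open interval I containing neither 0 nor c. Let σ be a three times continuously differentiable (C³) real-valued function on I, nowhere zero on I, satisfying equation (20.2) on I. Define on I: Q = 2(φ−c)σ, τ = σ + (φ−c)σ', Y = 2mσ + 2(φ−c)σ', μ = −(m+1)σ' − (φ−c)σ'', λ = μ + 2(m−1)(φ−c)σ'/φ, and s = 2μ + 2(m−1)λ. Then the septuple (Q, Y, s, σ, τ, λ, μ) satisfies the system (10.1), the equations (10.2) and the constraints (10.3) on I, with σ ≠ 0 everywhere and Q = 2(φ−c)σ on I; and it is the unique septuple of C¹ functions on I with the given function σ as its σ-component which satisfies (10.1)–(10.3) together with Q = 2(φ−c)σ on I. -/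
open Set

/-- A function that is `C³` on an open set is three times differentiable at each of its points. -/
theorem ContDiffOn.hasDerivAt_three {f : ℝ → ℝ} {u : Set ℝ} (hu : IsOpen u)
    (hf : ContDiffOn ℝ 3 f u) :
    (∀ x ∈ u, HasDerivAt f (deriv f x) x) ∧
    (∀ x ∈ u, HasDerivAt (deriv f) (deriv (deriv f) x) x) ∧
    (∀ x ∈ u, HasDerivAt (deriv (deriv f)) (deriv (deriv (deriv f)) x) x) := by
  have h1 : ContDiffOn ℝ 2 (deriv f) u := hf.deriv_of_isOpen hu (by norm_num)
  have h2 : ContDiffOn ℝ 1 (deriv (deriv f)) u := h1.deriv_of_isOpen hu (by norm_num)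
  have key : ∀ {g : ℝ → ℝ}, DifferentiableOn ℝ g u → ∀ x ∈ u, HasDerivAt g (deriv g x) x :=
    fun hg x hx => ((hg x hx).differentiableAt (hu.mem_nhds hx)).hasDerivAt
  exact ⟨key (hf.differentiableOn (by norm_num)), key (h1.differentiableOn (by norm_num)),
    key (h2.differentiableOn (by norm_num))⟩

/-- From a nowhere-zero `C³` solution `σ` of (20.2) on an interval containing
neither `0` nor `c`, the explicit formulas produce the unique septuple of `C¹` functions with
`σ`-component `σ` satisfying (10.1)--(10.3) together with `Q = 2(φ−c)σ`. -/
theorem stmt_6 (m : ℕ) (hm : 2 ≤ m) (c : ℝ) (p q : ℝ) (hpq : p < q)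
    (h0 : (0 : ℝ) ∉ Ioo p q) (hcI : c ∉ Ioo p q)
    (σ : ℝ → ℝ) (hσ : ContDiffOn ℝ 3 σ (Ioo p q))
    (hσ0 : ∀ x ∈ Ioo p q, σ x ≠ 0)
    (h202 : ∀ x ∈ Ioo p q,
      x ^ 2 * (x - c) * deriv (deriv (deriv σ)) x =
        (((m : ℝ) - 4) * x ^ 2 - 2 * ((m : ℝ) - 1) * c * x) * deriv (deriv σ) x +
          2 * ((m : ℝ) - 1) * (x + c) * deriv σ x)
    (Q Y s τ lm μ : ℝ → ℝ)
    (hQdef : ∀ x, Q x = 2 * (x - c) * σ x)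
    (hτdef : ∀ x, τ x = σ x + (x - c) * deriv σ x)
    (hYdef : ∀ x, Y x = 2 * (m : ℝ) * σ x + 2 * (x - c) * deriv σ x)
    (hμdef : ∀ x, μ x = -((m : ℝ) + 1) * deriv σ x - (x - c) * deriv (deriv σ) x)
    (hlmdef : ∀ x, lm x = μ x + 2 * ((m : ℝ) - 1) * (x - c) * deriv σ x / x)
    (hsdef : ∀ x, s x = 2 * μ x + 2 * ((m : ℝ) - 1) * lm x) :
    (ContDiffOn ℝ 1 Q (Ioo p q) ∧ ContDiffOn ℝ 1 Y (Ioo p q) ∧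
      ContDiffOn ℝ 1 s (Ioo p q) ∧ ContDiffOn ℝ 1 σ (Ioo p q) ∧
      ContDiffOn ℝ 1 τ (Ioo p q) ∧ ContDiffOn ℝ 1 lm (Ioo p q) ∧
      ContDiffOn ℝ 1 μ (Ioo p q) ∧
      Sys101 m (Ioo p q) Q Y σ τ lm μ ∧ Eqs102 m (Ioo p q) Q s σ τ lm μ ∧
      Con103 m (Ioo p q) Q Y s σ τ lm μ ∧
      (∀ x ∈ Ioo p q, σ x ≠ 0) ∧ (∀ x ∈ Ioo p q, Q x = 2 * (x - c) * σ x)) ∧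
    (∀ Q' Y' s' τ' lm' μ' : ℝ → ℝ,
      ContDiffOn ℝ 1 Q' (Ioo p q) → ContDiffOn ℝ 1 Y' (Ioo p q) →
      ContDiffOn ℝ 1 s' (Ioo p q) → ContDiffOn ℝ 1 τ' (Ioo p q) →
      ContDiffOn ℝ 1 lm' (Ioo p q) → ContDiffOn ℝ 1 μ' (Ioo p q) →
      Sys101 m (Ioo p q) Q' Y' σ τ' lm' μ' →
      Eqs102 m (Ioo p q) Q' s' σ τ' lm' μ' →
      Con103 m (Ioo p q) Q' Y' s' σ τ' lm' μ' →
      (∀ x ∈ Ioo p q, Q' x = 2 * (x - c) * σ x) →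
      ∀ x ∈ Ioo p q,
        Q' x = Q x ∧ Y' x = Y x ∧ s' x = s x ∧ τ' x = τ x ∧
        lm' x = lm x ∧ μ' x = μ x) := by
  have hx0 : ∀ x ∈ Ioo p q, x ≠ 0 := fun x hx h => h0 (h ▸ hx)
  have hxc : ∀ x ∈ Ioo p q, x - c ≠ 0 := fun x hx h => hcI (sub_eq_zero.mp h ▸ hx)
  obtain ⟨hd1, hd2, hd3⟩ := ContDiffOn.hasDerivAt_three isOpen_Ioo hσ
  have hc1 : ContDiffOn ℝ 2 (deriv σ) (Ioo p q) :=
    hσ.deriv_of_isOpen isOpen_Ioo (by norm_num)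
  have hc2 : ContDiffOn ℝ 1 (deriv (deriv σ)) (Ioo p q) :=
    hc1.deriv_of_isOpen isOpen_Ioo (by norm_num)
  have hc0' : ContDiffOn ℝ 1 σ (Ioo p q) := hσ.of_le (by norm_num)
  have hc1' : ContDiffOn ℝ 1 (deriv σ) (Ioo p q) := hc1.of_le (by norm_num)
  obtain rfl : Q = fun x => 2 * (x - c) * σ x := funext hQdef
  obtain rfl : τ = fun x => σ x + (x - c) * deriv σ x := funext hτdef
  obtain rfl : Y = fun x => 2 * (m : ℝ) * σ x + 2 * (x - c) * deriv σ x := funext hYdef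
  have hcμ : ContDiffOn ℝ 1 μ (Ioo p q) := by
    rw [funext hμdef]
    fun_prop
  have hcl : ContDiffOn ℝ 1 lm (Ioo p q) := by
    rw [funext hlmdef]
    exact hcμ.add (ContDiffOn.div (by fun_prop) contDiffOn_id hx0)
  have hcs : ContDiffOn ℝ 1 s (Ioo p q) := by
    rw [funext hsdef]
    fun_prop
  have hlin : ∀ x : ℝ, HasDerivAt (fun x => x - c) 1 x := fun x => (hasDerivAt_id x).sub_const c
  have hQ' : ∀ x ∈ Ioo p q, HasDerivAt (fun x => 2 * (x - c) * σ x)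
      (2 * (σ x + (x - c) * deriv σ x)) x := fun x hx => by
    refine HasDerivAt.congr_deriv (((hlin x).const_mul 2).mul (hd1 x hx)) ?_
    ring
  have hτ' : ∀ x ∈ Ioo p q, HasDerivAt (fun x => σ x + (x - c) * deriv σ x)
      (2 * deriv σ x + (x - c) * deriv (deriv σ) x) x := fun x hx => by
    refine HasDerivAt.congr_deriv ((hd1 x hx).add ((hlin x).mul (hd2 x hx))) ?_
    ring
  have hY' : ∀ x ∈ Ioo p q, HasDerivAt (fun x => 2 * (m : ℝ) * σ x + 2 * (x - c) * deriv σ x)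
      (-2 * μ x) x := fun x hx => by
    refine HasDerivAt.congr_deriv (((hd1 x hx).const_mul (2 * (m : ℝ))).add
      (((hlin x).const_mul 2).mul (hd2 x hx))) ?_
    rw [hμdef]
    ring
  have hμ' : ∀ x ∈ Ioo p q, HasDerivAt μ (2 * ((m : ℝ) - 1) *
      (-2 * deriv σ x - (x - c) * deriv (deriv σ) x + (x - c) * deriv σ x / x) / x) x :=
    fun x hx => by
      have hx' := hx0 x hx
      rw [funext hμdef]
      refine HasDerivAt.congr_deriv (((hd2 x hx).const_mul (-((m : ℝ) + 1))).sub
        ((hlin x).mul (hd3 x hx))) ?_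
      field_simp
      linear_combination -h202 x hx
  have hl' : ∀ x ∈ Ioo p q, HasDerivAt lm (-2 * ((m : ℝ) - 1) * deriv σ x / x) x :=
    fun x hx => by
      have hx' := hx0 x hx
      rw [funext hlmdef]
      refine HasDerivAt.congr_deriv ((hμ' x hx).add ((((hlin x).const_mul (2 * ((m : ℝ) - 1))).mul
        (hd2 x hx)).div (hasDerivAt_id x) hx')) ?_
      simp only [Pi.mul_apply]
      field_simp
      ring
  have hs' : ∀ x ∈ Ioo p q, HasDerivAt s (4 * ((m : ℝ) - 1) *
      (-((m : ℝ) + 1) * deriv σ x - (x - c) * deriv (deriv σ) x + (x - c) * deriv σ x / x) / x) x :=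
    fun x hx => by
      have hx' := hx0 x hx
      rw [funext hsdef]
      refine HasDerivAt.congr_deriv (((hμ' x hx).const_mul 2).add
        ((hl' x hx).const_mul (2 * ((m : ℝ) - 1)))) ?_
      field_simp
      ring
  refine ⟨⟨by fun_prop, by fun_prop, hcs, hc0', by fun_prop, hcl, hcμ, fun x hx => ?_,
    fun x hx => ?_, ⟨fun x hx => ?_, fun x hx => ⟨?_, hsdef x⟩, fun x hx => ?_⟩, hσ0,
    fun x _ => rfl⟩, ?_⟩
  · have hx' := hx0 x hx
    refine ⟨(hQ' x hx).deriv, (hY' x hx).deriv, ?_, ?_, ?_⟩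
    · ring
    · rw [(hτ' x hx).deriv, hμdef]
      ring
    · rw [(hl' x hx).deriv, hlmdef]
      field_simp
      ring
  · have hx' := hx0 x hx
    rw [(hμ' x hx).deriv, (hs' x hx).deriv, hlmdef, hμdef]
    constructor <;> field_simp <;> ring
  · exact mul_ne_zero (mul_ne_zero two_ne_zero (hxc x hx)) (hσ0 x hx)
  · ring
  · have hx' := hx0 x hx
    rw [hlmdef]
    field_simp
    ring
  · intro Q' Y' s' τ' lm' μ' _ _ _ _ _ _ hsys _ ⟨_, hYs, hcon⟩ hQ
    have hτe : ∀ x ∈ Ioo p q, τ' x = σ x + (x - c) * deriv σ x := fun x hx => by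
      have h := (hsys x hx).1
      rw [(Set.EqOn.eventuallyEq_of_mem hQ (isOpen_Ioo.mem_nhds hx)).deriv_eq,
        (hQ' x hx).deriv] at h
      linarith
    have hYe : ∀ x ∈ Ioo p q, Y' x = 2 * (m : ℝ) * σ x + 2 * (x - c) * deriv σ x :=
      fun x hx => by
        rw [(hYs x hx).1, hτe x hx]
        ring
    have hμe : ∀ x ∈ Ioo p q, μ' x = μ x := fun x hx => by
      have h := (hsys x hx).2.1
      rw [(Set.EqOn.eventuallyEq_of_mem hYe (isOpen_Ioo.mem_nhds hx)).deriv_eq,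
        (hY' x hx).deriv] at h
      linarith
    have hle : ∀ x ∈ Ioo p q, lm' x = lm x := fun x hx => by
      have hx' := hx0 x hx
      have h := hcon x hx
      rw [hτe x hx, hμe x hx] at h
      rw [hlmdef]
      field_simp
      linear_combination -h
    exact fun x hx => ⟨hQ x hx, hYe x hx, by rw [(hYs x hx).2, hμe x hx, hle x hx, hsdef],
      hτe x hx, hle x hx, hμe x hx⟩
end

section
/- Fix an integer m ≥ 2 and a real number c, and let I be an open interval with 0 ∉ I. A three times differentiable real-valued function σ of φ on I satisfies equation (20.2) on I if and only if the function φ ↦ mσ − (φ−c)²σ'' − m(φ−c)σ' + 2(m−1)(φ−c)²σ'/φ is constant on I. -/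
open Set

open Filter Topology in
/-- If `f` is differentiable near `c` and `(x - c) f'(x)` extends continuously to `c` by `h`,
then `h` vanishes at `c`. -/
theorem eq_zero_of_sub_mul_deriv_eq {f h : ℝ → ℝ} {c : ℝ} {s : Set ℝ} (hs : s ∈ 𝓝 c)
    (hf : ∀ x ∈ s, DifferentiableAt ℝ f x) (hh : ContinuousAt h c)
    (heq : ∀ x ∈ s, x ≠ c → (x - c) * deriv f x = h x) : h c = 0 := by
  have hc : c ∈ s := mem_of_mem_nhds hs
  have key : ∀ x ∈ s, HasDerivAt (fun y => (y - c) * f y) (1 * f x + (x - c) * deriv f x) x :=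
    fun x hx => ((hasDerivAt_id x).sub_const c).mul (hf x hx).hasDerivAt
  have hlim : Tendsto (fun x => deriv (fun y => (y - c) * f y) x) (𝓝[>] c) (𝓝 (f c + h c)) := by
    have h1 : Tendsto (fun x => f x + h x) (𝓝[>] c) (𝓝 (f c + h c)) :=
      ((hf c hc).continuousAt.add hh).tendsto.mono_left nhdsWithin_le_nhds
    refine h1.congr' ?_
    filter_upwards [self_mem_nhdsWithin, mem_nhdsWithin_of_mem_nhds hs] with x hx hxs
    rw [(key x hxs).deriv, heq x hxs (ne_of_gt hx), one_mul]
  have h2 := hasDerivWithinAt_Ici_of_tendsto_deriv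
    (fun x hx => (key x hx).differentiableAt.differentiableWithinAt)
    (key c hc).continuousAt.continuousWithinAt (mem_nhdsWithin_of_mem_nhds hs) hlim
  have h3 := (uniqueDiffWithinAt_Ici c).eq_deriv _ h2 (key c hc).hasDerivWithinAt
  linarith

/-- The derivative of the first integral: a multiple of the defect in the differential equation. -/
theorem hasDerivAt_first_integral {m c x : ℝ} {σ : ℝ → ℝ} (hx : x ≠ 0)
    (h1 : DifferentiableAt ℝ σ x) (h2 : DifferentiableAt ℝ (deriv σ) x)
    (h3 : DifferentiableAt ℝ (deriv (deriv σ)) x) :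
    HasDerivAt (fun x => m * σ x - (x - c) ^ 2 * deriv (deriv σ) x - m * (x - c) * deriv σ x +
        2 * (m - 1) * (x - c) ^ 2 * deriv σ x / x)
      ((x - c) / x ^ 2 * (((m - 4) * x ^ 2 - 2 * (m - 1) * c * x) * deriv (deriv σ) x +
          2 * (m - 1) * (x + c) * deriv σ x - x ^ 2 * (x - c) * deriv (deriv (deriv σ)) x)) x := by
  have hl : HasDerivAt (fun y : ℝ => y - c) 1 x := (hasDerivAt_id x).sub_const c
  have hq := hl.fun_pow 2
  refine ((((h1.hasDerivAt.const_mul m).sub (hq.mul h3.hasDerivAt)).sub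
    ((hl.const_mul m).mul h2.hasDerivAt)).add
    (((hq.const_mul (2 * (m - 1))).mul h2.hasDerivAt).div (hasDerivAt_id x) hx)).congr_deriv ?_
  simp only [id, Nat.cast_ofNat, Pi.mul_apply]
  field_simp
  ring

/-- Equation (20.2) holds on an open interval avoiding `0` if and only if
the expression (20.3) is constant there. -/
theorem stmt_7 (m : ℕ) (hm : 2 ≤ m) (c : ℝ) (p q : ℝ) (hpq : p < q)
    (h0 : (0 : ℝ) ∉ Ioo p q) (σ : ℝ → ℝ)
    (hd1 : ∀ x ∈ Ioo p q, DifferentiableAt ℝ σ x)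
    (hd2 : ∀ x ∈ Ioo p q, DifferentiableAt ℝ (deriv σ) x)
    (hd3 : ∀ x ∈ Ioo p q, DifferentiableAt ℝ (deriv (deriv σ)) x) :
    (∀ x ∈ Ioo p q,
      x ^ 2 * (x - c) * deriv (deriv (deriv σ)) x =
        (((m : ℝ) - 4) * x ^ 2 - 2 * ((m : ℝ) - 1) * c * x) * deriv (deriv σ) x +
          2 * ((m : ℝ) - 1) * (x + c) * deriv σ x) ↔
    (∃ k : ℝ, ∀ x ∈ Ioo p q,
      (m : ℝ) * σ x - (x - c) ^ 2 * deriv (deriv σ) x - (m : ℝ) * (x - c) * deriv σ x +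
        2 * ((m : ℝ) - 1) * (x - c) ^ 2 * deriv σ x / x = k) := by
  have hne : ∀ x ∈ Ioo p q, x ≠ 0 := fun x hx h => h0 (h ▸ hx)
  have hder := fun x hx =>
    hasDerivAt_first_integral (m := m) (c := c) (hne x hx) (hd1 x hx) (hd2 x hx) (hd3 x hx)
  constructor
  · intro h
    refine isOpen_Ioo.exists_is_const_of_deriv_eq_zero isPreconnected_Ioo
      (fun x hx => (hder x hx).differentiableAt.differentiableWithinAt) fun x hx => ?_
    rw [(hder x hx).deriv, h x hx, sub_self, mul_zero, Pi.zero_apply]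
  · rintro ⟨k, hk⟩
    have off_center : ∀ x ∈ Ioo p q, x ≠ c →
        x ^ 2 * (x - c) * deriv (deriv (deriv σ)) x =
          (((m : ℝ) - 4) * x ^ 2 - 2 * ((m : ℝ) - 1) * c * x) * deriv (deriv σ) x +
            2 * ((m : ℝ) - 1) * (x + c) * deriv σ x := by
      intro x hx hxc
      have hconst := (hasDerivAt_const x k).congr_of_eventuallyEq
        (Filter.eventuallyEq_of_mem (isOpen_Ioo.mem_nhds hx) hk)
      have hzero := (hder x hx).unique hconst
      rcases mul_eq_zero.1 hzero with h | h
      · exact absurd h (div_ne_zero (sub_ne_zero.2 hxc) (pow_ne_zero 2 (hne x hx)))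
      · linarith
    intro x hx
    rcases ne_or_eq x c with hxc | rfl
    · exact off_center x hx hxc
    have hx0 := hne x hx
    have hzero := eq_zero_of_sub_mul_deriv_eq (isOpen_Ioo.mem_nhds hx) hd3
      (h := fun y => ((((m : ℝ) - 4) * y ^ 2 - 2 * ((m : ℝ) - 1) * x * y) * deriv (deriv σ) y +
        2 * ((m : ℝ) - 1) * (y + x) * deriv σ y) / y ^ 2)
      (by
        have h2 := (hd2 x hx).continuousAt
        have h3 := (hd3 x hx).continuousAt
        exact ContinuousAt.div (by fun_prop) (by fun_prop) (pow_ne_zero 2 hx0))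
      (fun y hy hyx => by
        rw [← off_center y hy hyx]
        have := hne y hy
        field_simp)
    rw [(div_eq_zero_iff.1 hzero).resolve_right (pow_ne_zero 2 hx0)]
    ring
end

section
/- Fix an integer m ≥ 1 and define F, E and Ξ as in the context. Then for every real t ≠ 1: t(t−2)F'(t) = Ξ(t)F(t), and t(t−2)E'(t) = Ξ(t)E(t) + 2(2m−1)E(0). -/
open Set

/-- The rational function `F(t) = (t−2)·t^{2m−1}/(t−1)^m` of §21. -/
noncomputable def Ffun (m : ℕ) : ℝ → ℝ := fun t =>
  (t - 2) * t ^ (2 * m - 1) / (t - 1) ^ m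

/-- The polynomial `E(t) = (t−1)·∑_{k=1}^m (k/m)·binom(2m−k−1, m−1)·t^{k−1}` of §21. -/
noncomputable def Efun (m : ℕ) : ℝ → ℝ := fun t =>
  (t - 1) * ∑ k ∈ Finset.Icc 1 m,
    ((k : ℝ) / (m : ℝ)) * ((2 * m - k - 1).choose (m - 1) : ℝ) * t ^ (k - 1)

/-- The function `Ξ(t) = m(t−1) + m/(t−1) − 2(m−1)` of §21. -/
noncomputable def XiFun (m : ℕ) : ℝ → ℝ := fun t =>
  (m : ℝ) * (t - 1) + (m : ℝ) / (t - 1) - 2 * ((m : ℝ) - 1)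

/-- If `(2m - j - 2) a (j+1) = (m - j - 1) a j`, then a truncation of `∑ (j+1) a j t^j` satisfies the
differential equation `t (t-1) (t-2) S' = ((m-1) t² - 4 (m-1) t + (4m-2)) S + const` up to a
boundary term. -/
theorem sum_range_boundary_term (m : ℕ) (a : ℕ → ℝ)
    (ha : ∀ j, j + 1 < m → (2 * (m : ℝ) - j - 2) * a (j + 1) = ((m : ℝ) - j - 1) * a j)
    (t : ℝ) (n : ℕ) (hn : n < m) :
    ∑ j ∈ Finset.range (n + 1), ((t - 1) * (t - 2) * j -
        (((m : ℝ) - 1) * t ^ 2 - 4 * ((m : ℝ) - 1) * t + (4 * m - 2))) * ((j + 1) * a j * t ^ j) =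
      -(2 * (2 * (m : ℝ) - 1)) * a 0 +
        a n * ((m : ℝ) - n - 1) * t ^ (n + 1) * (2 * (n + 2) - (n + 1) * t) := by
  induction n with
  | zero => simp; ring
  | succ n ih =>
    rw [Finset.sum_range_succ, ih (by omega)]
    push_cast
    linear_combination (-t ^ (n + 1) * (2 * ((n : ℝ) + 2) - (n + 1) * t)) * ha n hn

theorem choose_central_step (m j : ℕ) (hj : j + 1 < m) :
    (2 * (m : ℝ) - j - 2) * ((2 * m - (j + 1 + 1) - 1).choose (m - 1) : ℝ) =
      ((m : ℝ) - j - 1) * ((2 * m - (j + 1) - 1).choose (m - 1) : ℝ) := by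
  obtain ⟨d, rfl⟩ : ∃ d, m = j + 2 + d := ⟨m - (j + 2), by omega⟩
  have h := Nat.choose_mul_succ_eq (j + 2 * d + 1) (j + 1 + d)
  rw [show j + 2 * d + 1 + 1 - (j + 1 + d) = d + 1 by omega] at h
  rw [show 2 * (j + 2 + d) - (j + 1 + 1) - 1 = j + 2 * d + 1 by omega,
    show 2 * (j + 2 + d) - (j + 1) - 1 = j + 2 * d + 1 + 1 by omega,
    show j + 2 + d - 1 = j + 1 + d by omega]
  have h' : ((j + 2 * d + 1).choose (j + 1 + d) : ℝ) * (j + 2 * d + 1 + 1) =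
      ((j + 2 * d + 1 + 1).choose (j + 1 + d) : ℝ) * (d + 1) := by exact_mod_cast h
  push_cast
  linear_combination h'

theorem Efun_eq_sum_range (m : ℕ) (t : ℝ) :
    Efun m t = (t - 1) * ∑ j ∈ Finset.range m,
      ((j : ℝ) + 1) * (((2 * m - (j + 1) - 1).choose (m - 1) : ℝ) / m) * t ^ j := by
  unfold Efun
  rw [← Finset.Ico_add_one_right_eq_Icc, Finset.sum_Ico_eq_sum_range, Nat.add_sub_cancel]
  congr 1
  refine Finset.sum_congr rfl fun j _ => ?_
  rw [add_comm 1 j, Nat.add_sub_cancel]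
  push_cast
  ring

theorem mul_deriv_Ffun (m : ℕ) (hm : 1 ≤ m) (t : ℝ) (ht : t ≠ 1) :
    t * (t - 2) * deriv (Ffun m) t = XiFun m t * Ffun m t := by
  obtain ⟨p, rfl⟩ : ∃ p, m = p + 1 := ⟨m - 1, by omega⟩
  have h1 : t - 1 ≠ 0 := sub_ne_zero.mpr ht
  have hd := ((((hasDerivAt_id t).sub_const 2).mul ((hasDerivAt_id t).pow (2 * p + 1))).div
    (((hasDerivAt_id t).sub_const 1).pow (p + 1)) (pow_ne_zero _ h1))
  have hF : HasDerivAt (Ffun (p + 1)) _ t := hd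
  rw [hF.deriv]
  simp only [XiFun, Ffun, id, Pi.mul_apply, Pi.pow_apply, Nat.add_sub_cancel,
    show 2 * (p + 1) - 1 = 2 * p + 1 by omega]
  push_cast
  field_simp
  ring

theorem mul_deriv_Efun (m : ℕ) (hm : 1 ≤ m) (t : ℝ) (ht : t ≠ 1) :
    t * (t - 2) * deriv (Efun m) t =
      XiFun m t * Efun m t + 2 * (2 * (m : ℝ) - 1) * Efun m 0 := by
  have h1 : t - 1 ≠ 0 := sub_ne_zero.mpr ht
  set a : ℕ → ℝ := fun j => ((2 * m - (j + 1) - 1).choose (m - 1) : ℝ) / m with ha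
  have hE : Efun m = fun t => (t - 1) * ∑ j ∈ Finset.range m, ((j : ℝ) + 1) * a j * t ^ j :=
    funext (Efun_eq_sum_range m)
  have hE0 : Efun m 0 = -a 0 := by
    obtain ⟨p, rfl⟩ : ∃ p, m = p + 1 := ⟨m - 1, by omega⟩
    simp [hE, Finset.sum_range_succ']
  have hd : HasDerivAt (Efun m) (1 * (∑ j ∈ Finset.range m, ((j : ℝ) + 1) * a j * t ^ j) +
      (t - 1) * ∑ j ∈ Finset.range m, ((j : ℝ) + 1) * a j * (j * t ^ (j - 1))) t := by
    rw [hE]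
    exact ((hasDerivAt_id t).sub_const 1).mul
      (HasDerivAt.fun_sum fun j _ => (hasDerivAt_pow j t).const_mul _)
  have hrec (j : ℕ) (hj : j + 1 < m) :
      (2 * (m : ℝ) - j - 2) * a (j + 1) = ((m : ℝ) - j - 1) * a j := by
    simp only [ha, ← mul_div_assoc, choose_central_step m j hj]
  have hsum := sum_range_boundary_term m a hrec t (m - 1) (by omega)
  rw [Nat.sub_add_cancel hm, Nat.cast_sub hm] at hsum
  have hsplit : ∑ j ∈ Finset.range m, ((t - 1) * (t - 2) * j -
        (((m : ℝ) - 1) * t ^ 2 - 4 * ((m : ℝ) - 1) * t + (4 * m - 2))) * ((j + 1) * a j * t ^ j) =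
      (t - 1) * (t - 2) *
          (t * ∑ j ∈ Finset.range m, ((j : ℝ) + 1) * a j * (j * t ^ (j - 1))) -
        (((m : ℝ) - 1) * t ^ 2 - 4 * ((m : ℝ) - 1) * t + (4 * m - 2)) *
          ∑ j ∈ Finset.range m, ((j : ℝ) + 1) * a j * t ^ j := by
    simp only [Finset.mul_sum, ← Finset.sum_sub_distrib]
    refine Finset.sum_congr rfl fun j _ => ?_
    rcases j with _ | j
    · simp; ring
    · rw [Nat.add_sub_cancel]
      ring
  rw [hsplit] at hsum
  rw [hd.deriv, hE0, hE]
  have hXi : XiFun m t * (t - 1) = m * (t - 1) ^ 2 + m - 2 * ((m : ℝ) - 1) * (t - 1) := by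
    unfold XiFun
    field_simp
  push_cast at hsum
  linear_combination hsum - (∑ j ∈ Finset.range m, ((j : ℝ) + 1) * a j * t ^ j) * hXi

/-- Lemma 21.1. -/
theorem stmt_9 (m : ℕ) (hm : 1 ≤ m) :
    ∀ t : ℝ, t ≠ 1 →
      t * (t - 2) * deriv (Ffun m) t = XiFun m t * Ffun m t ∧
      t * (t - 2) * deriv (Efun m) t =
        XiFun m t * Efun m t + 2 * (2 * (m : ℝ) - 1) * Efun m 0 := by
  exact fun t ht => ⟨mul_deriv_Ffun m hm t ht, mul_deriv_Efun m hm t ht⟩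
end

section
/- Fix an integer m ≥ 1 and define F and E as in the context. Then for every real t with t ∉ {0, 1, 2} (so that F(t) ≠ 0 and F is differentiable at t): t(t−2)·d/dt(E(t)/F(t)) = 2(2m−1)·E(0)/F(t). -/
open Set

lemma choose_two_mul_sub_recurrence {m N : ℕ} (hN : N < m) :
    ((m : ℝ) - N) * ((2 * m - N - 1).choose (m - 1) : ℝ) =
      (2 * (m : ℝ) - N - 1) * ((2 * m - (N + 1) - 1).choose (m - 1) : ℝ) := by
  obtain ⟨d, rfl⟩ := Nat.exists_eq_add_of_lt hN
  have h := Nat.choose_mul_succ_eq (N + 2 * d) (N + d)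
  rw [show N + 2 * d + 1 - (N + d) = d + 1 by omega] at h
  rw [show 2 * (N + d + 1) - N - 1 = N + 2 * d + 1 by omega,
    show 2 * (N + d + 1) - (N + 1) - 1 = N + 2 * d by omega,
    show N + d + 1 - 1 = N + d by omega]
  have h' : ((N + 2 * d).choose (N + d) : ℝ) * (N + 2 * d + 1) =
      ((N + 2 * d + 1).choose (N + d) : ℝ) * (d + 1) := by exact_mod_cast h
  push_cast
  linear_combination -h'

/-- The first-order differential operator arising from the derivative of `E(t) / F(t)`, applied to
the partial sums of `E(t) / (t - 1)`. -/
lemma differential_operator_partial_sum {m N : ℕ} (hm : 1 ≤ m) (hN : N ≤ m) (t : ℝ) :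
    t * (t - 1) * (t - 2) * ∑ k ∈ Finset.Icc 1 N,
        ((k : ℝ) / m) * ((2 * m - k - 1).choose (m - 1) : ℝ) *
          (((k - 1 : ℕ) : ℝ) * t ^ (k - 1 - 1)) +
      ((1 - (m : ℝ)) * t ^ 2 + (4 * m - 4) * t - 2 * (2 * m - 1)) * ∑ k ∈ Finset.Icc 1 N,
        ((k : ℝ) / m) * ((2 * m - k - 1).choose (m - 1) : ℝ) * t ^ (k - 1) =
      -2 * ((2 * m - 1).choose (m - 1) : ℝ) +
        ((m : ℝ) - N) / m * ((2 * m - N - 1).choose (m - 1) : ℝ) * t ^ N *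
          (2 * (N + 1) - N * t) := by
  have hm0 : (m : ℝ) ≠ 0 := by positivity
  induction N with
  | zero => simp [hm0]; ring
  | succ N ih =>
    have hpow : t * ((N : ℝ) * t ^ (N - 1)) = N * t ^ N := by
      rcases N with _ | N
      · simp
      · simp only [Nat.add_sub_cancel]; ring
    rw [Finset.sum_Icc_succ_top (by omega), Finset.sum_Icc_succ_top (by omega)]
    have ih := ih (by omega)
    have hrec := choose_two_mul_sub_recurrence (m := m) (N := N) (by omega)
    simp only [Nat.add_sub_cancel]
    push_cast
    set c := ((2 * m - (N + 1) - 1).choose (m - 1) : ℝ)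
    set c₀ := ((2 * m - N - 1).choose (m - 1) : ℝ)
    have hinv : (m : ℝ) * (m : ℝ)⁻¹ = 1 := mul_inv_cancel₀ hm0
    simp only [div_eq_mul_inv] at ih ⊢
    linear_combination ih + (t - 1) * (t - 2) * ((N + 1) * (m : ℝ)⁻¹ * c) * hpow +
      (m : ℝ)⁻¹ * t ^ N * (2 * (N + 1) - N * t) * hrec

lemma Efun_zero {m : ℕ} (hm : 1 ≤ m) :
    (2 * (m : ℝ) - 1) * Efun m 0 = -((2 * m - 1).choose (m - 1) : ℝ) := by
  have hm0 : (m : ℝ) ≠ 0 := by positivity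
  have hrec := choose_two_mul_sub_recurrence (m := m) (N := 0) (by omega)
  have hE : Efun m 0 = -(((2 * m - 1 - 1).choose (m - 1) : ℝ) / m) := by
    unfold Efun
    rw [Finset.sum_eq_single_of_mem 1 (by simp [hm])]
    · simp; ring
    · intro k hk hk1
      rw [Finset.mem_Icc] at hk
      rw [zero_pow (by omega), mul_zero]
  rw [hE]
  simp only [Nat.cast_zero, sub_zero, Nat.sub_zero, zero_add] at hrec
  field_simp
  linear_combination hrec

/-- formula (21.3.ii). -/
theorem stmt_11 (m : ℕ) (hm : 1 ≤ m) :
    ∀ t : ℝ, t ≠ 0 → t ≠ 1 → t ≠ 2 →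
      t * (t - 2) * deriv (fun u => Efun m u / Ffun m u) t =
        2 * (2 * (m : ℝ) - 1) * Efun m 0 / Ffun m t := by
  intro t h0 h1 h2
  have h1' : t - 1 ≠ 0 := sub_ne_zero.mpr h1
  have h2' : t - 2 ≠ 0 := sub_ne_zero.mpr h2
  have hode := differential_operator_partial_sum hm le_rfl t
  rw [mul_assoc 2, Efun_zero hm]
  have hP : HasDerivAt (fun u : ℝ => ∑ k ∈ Finset.Icc 1 m,
      ((k : ℝ) / m) * ((2 * m - k - 1).choose (m - 1) : ℝ) * u ^ (k - 1))
      (∑ k ∈ Finset.Icc 1 m, ((k : ℝ) / m) * ((2 * m - k - 1).choose (m - 1) : ℝ) *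
        (((k - 1 : ℕ) : ℝ) * t ^ (k - 1 - 1))) t :=
    HasDerivAt.fun_sum fun k _ => (hasDerivAt_pow (k - 1) t).const_mul _
  have hsub (a : ℝ) : HasDerivAt (fun u : ℝ => u - a) 1 t := (hasDerivAt_id t).sub_const a
  have hF : HasDerivAt (Ffun m) _ t :=
    ((hsub 2).mul (hasDerivAt_pow (2 * m - 1) t)).div ((hsub 1).pow m) (pow_ne_zero m h1')
  have hF0 : Ffun m t ≠ 0 := by
    unfold Ffun
    positivity
  have hE : HasDerivAt (Efun m) _ t := (hsub 1).mul hP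
  rw [(hE.fun_div hF hF0).deriv]
  simp only [Ffun, Efun, Pi.mul_apply]
  generalize (∑ k ∈ Finset.Icc 1 m, _ * (_ * t ^ (k - 1 - 1)) : ℝ) = D at hode ⊢
  generalize (∑ k ∈ Finset.Icc 1 m, _ * t ^ (k - 1) : ℝ) = P at hode ⊢
  obtain ⟨n, rfl⟩ := Nat.exists_eq_add_of_le' hm
  rw [show 2 * (n + 1) - 1 = 2 * n + 1 by omega] at hode ⊢
  simp only [Nat.add_sub_cancel, sub_self, zero_div, zero_mul, add_zero] at hode ⊢
  push_cast at hode ⊢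
  field_simp
  linear_combination (t - 1) ^ (n + 1) * t ^ (2 * n + 1) * hode
end

section
/- Fix an integer m ≥ 1, a real number c ≠ 0, and an open interval I of the variable φ containing neither 0 nor c. Then a three times continuously differentiable (C³) real-valued function σ on I satisfies equation (20.2) on I if and only if there exist real constants a, b, d such that σ(φ) = a + b·E(φ/c) + d·F(φ/c) for all φ ∈ I. Moreover, the three functions φ ↦ 1, φ ↦ E(φ/c), φ ↦ F(φ/c) are linearly independent over ℝ as functions on I, so the constants a, b, d are uniquely determined by σ. -/
open Set

open Polynomial in
/-- The polynomial `E(t) / (t - 1)`. -/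
noncomputable def cofactorPoly (m : ℕ) : ℝ[X] :=
  ∑ k ∈ Finset.range m,
    C (((k + 1 : ℕ) : ℝ) / (m : ℝ) * ((2 * m - (k + 1) - 1).choose (m - 1) : ℝ)) * X ^ k

open Polynomial in
/-- `Efun` as a polynomial. -/
noncomputable def Epoly (m : ℕ) : ℝ[X] := (X - 1) * cofactorPoly m

open Polynomial in
/-- The polynomial `Q` such that `Q t ^ (a - 1) (t - 1) ^ (b - 1)` is the derivative of
`P t ^ a (t - 1) ^ b`. -/
noncomputable def zpowDeriv (a b : ℤ) (P : ℝ[X]) : ℝ[X] :=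
  X * (X - 1) * derivative P + ((a : ℝ[X]) * (X - 1) + (b : ℝ[X]) * X) * P

open Polynomial in
/-- The numerator of the first derivative of `Ffun`. -/
noncomputable def Fnum₁ (m : ℕ) : ℝ[X] := zpowDeriv (2 * m - 1) (-m) (X - 2)

/-- The numerator of the second derivative of `Ffun`. -/
noncomputable def Fnum₂ (m : ℕ) : Polynomial ℝ := zpowDeriv (2 * m - 2) (-m - 1) (Fnum₁ m)

/-- The numerator of the third derivative of `Ffun`. -/
noncomputable def Fnum₃ (m : ℕ) : Polynomial ℝ := zpowDeriv (2 * m - 3) (-m - 2) (Fnum₂ m)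

open Polynomial in
/-- The numerator of the Wronskian of the derivatives of `Efun` and `Ffun`. -/
noncomputable def wronskianNum (m : ℕ) : ℝ[X] :=
  derivative (Epoly m) * Fnum₂ m - X * (X - 1) * derivative (derivative (Epoly m)) * Fnum₁ m

section PolynomialIdentities

open Polynomial

lemma coeff_cofactorPoly (m n : ℕ) :
    (cofactorPoly m).coeff n = if n < m then
      ((n + 1 : ℕ) : ℝ) / (m : ℝ) * ((2 * m - (n + 1) - 1).choose (m - 1) : ℝ) else 0 := by
  simp only [cofactorPoly, finsetSum_coeff, coeff_C_mul, coeff_X_pow]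
  simp

lemma coeff_cofactorPoly_succ (m n : ℕ) :
    ((n : ℝ) + 1) * (2 * m - 2 - n) * (cofactorPoly m).coeff (n + 1) =
      (n + 2) * (m - 1 - n) * (cofactorPoly m).coeff n := by
  rw [coeff_cofactorPoly, coeff_cofactorPoly]
  rcases lt_trichotomy (n + 1) m with h | h | h
  · obtain ⟨r, rfl⟩ : ∃ r, m = n + 2 + r := ⟨m - (n + 2), by omega⟩
    have key := Nat.choose_mul_succ_eq (n + 2 * r + 1) (n + 1 + r)
    have e1 : 2 * (n + 2 + r) - (n + 1 + 1) - 1 = n + 2 * r + 1 := by omega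
    have e2 : 2 * (n + 2 + r) - (n + 1) - 1 = n + 2 * r + 1 + 1 := by omega
    have e3 : n + 2 + r - 1 = n + 1 + r := by omega
    have e4 : n + 2 * r + 1 + 1 - (n + 1 + r) = r + 1 := by omega
    rw [e4] at key
    have key' : ((n + 2 * r + 1).choose (n + 1 + r) : ℝ) * (n + 2 * r + 1 + 1) =
      ((n + 2 * r + 1 + 1).choose (n + 1 + r) : ℝ) * (r + 1) := by exact_mod_cast key
    rw [if_pos h, if_pos (by omega), e1, e2, e3]
    push_cast
    linear_combination (((n : ℝ) + 1) * (n + 2) / (n + 2 + r)) * key'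
  · subst h
    simp
  · rw [if_neg (by omega), if_neg (by omega)]
    simp

lemma cofactorPoly_ode (m : ℕ) :
    X * (X - 1) * derivative (derivative (cofactorPoly m)) +
      (2 * ((m : ℝ[X]) - 1) - ((m : ℝ[X]) - 4) * X) * derivative (cofactorPoly m) -
        2 * ((m : ℝ[X]) - 1) * cofactorPoly m = 0 := by
  have h : X * (X * derivative (derivative (cofactorPoly m))) -
      X * derivative (derivative (cofactorPoly m)) +
      C (2 * ((m : ℝ) - 1)) * derivative (cofactorPoly m) -
      C ((m : ℝ) - 4) * (X * derivative (cofactorPoly m)) -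
        C (2 * ((m : ℝ) - 1)) * cofactorPoly m = 0 := by
    ext n
    have key := coeff_cofactorPoly_succ m n
    rcases n with _ | _ | n <;>
      simp only [coeff_add, coeff_sub, coeff_C_mul, coeff_X_mul, coeff_C_zero, coeff_derivative, coeff_zero, mul_coeff_zero, coeff_X_zero] <;>
      push_cast at key ⊢ <;>
      linear_combination key
  rw [← h]
  simp only [map_mul, map_sub, map_natCast, map_ofNat, map_one]
  ring

lemma Epoly_ode (m : ℕ) :
    X ^ 2 * (X - 1) * derivative (derivative (derivative (Epoly m))) =
      (((m : ℝ[X]) - 4) * X ^ 2 - 2 * ((m : ℝ[X]) - 1) * X) *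
          derivative (derivative (Epoly m)) +
        2 * ((m : ℝ[X]) - 1) * (X + 1) * derivative (Epoly m) := by
  have h := cofactorPoly_ode m
  have h' := congrArg derivative h
  simp [Epoly] at h' ⊢
  linear_combination X * (X - 1) * h' + (X + 1) * h

lemma Fnum_ode (m : ℕ) :
    Fnum₃ m = (((m : ℝ[X]) - 4) * X - 2 * ((m : ℝ[X]) - 1)) * Fnum₂ m +
      2 * ((m : ℝ[X]) - 1) * (X + 1) * (X - 1) * Fnum₁ m := by
  simp [Fnum₃, Fnum₂, Fnum₁, zpowDeriv]
  ring

lemma wronskianNum_ode (m : ℕ) :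
    X * derivative (wronskianNum m) = wronskianNum m := by
  have h := Epoly_ode m
  have h1 : Fnum₁ m = (m : ℝ[X]) * X ^ 2 + (2 - 4 * (m : ℝ[X])) * X + (4 * (m : ℝ[X]) - 2) := by
    simp [Fnum₁, zpowDeriv]
    ring
  simp [wronskianNum, Fnum₂, h1, zpowDeriv]
  linear_combination (-(m * X ^ 2 + (2 - 4 * m) * X + (4 * m - 2))) * h

lemma Polynomial.eq_C_mul_X_of_X_mul_derivative_eq {P : ℝ[X]} (h : X * derivative P = P) :
    P = C (P.coeff 1) * X := by
  ext n
  have hn := congrArg (fun Q => Q.coeff n) h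
  rcases n with _ | _ | n
  · simpa using hn.symm
  · simp
  · simp only [coeff_X_mul, coeff_derivative] at hn
    have : P.coeff (n + 2) * ((n : ℝ) + 1) = 0 := by push_cast at hn; linear_combination hn
    have h0 : P.coeff (n + 2) = 0 := by
      rcases mul_eq_zero.1 this with h | h
      · exact h
      · exact absurd h (by positivity)
    simp [h0]

lemma cofactorPoly_eval_one_pos {m : ℕ} (hm : 1 ≤ m) : 0 < (cofactorPoly m).eval 1 := by
  simp only [cofactorPoly, eval_finsetSum, eval_mul, eval_C, eval_pow, eval_X, one_pow, mul_one]
  refine Finset.sum_pos (fun k hk => ?_) ⟨0, Finset.mem_range.2 hm⟩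
  have hk := Finset.mem_range.1 hk
  have : 0 < (2 * m - (k + 1) - 1).choose (m - 1) := Nat.choose_pos (by omega)
  positivity

lemma wronskianNum_eval_ne_zero {m : ℕ} (hm : 1 ≤ m) {t : ℝ} (ht : t ≠ 0) :
    (wronskianNum m).eval t ≠ 0 := by
  have h := Polynomial.eq_C_mul_X_of_X_mul_derivative_eq (wronskianNum_ode m)
  have h1 : (wronskianNum m).eval 1 = (wronskianNum m).coeff 1 := by
    rw [h]; simp
  have h2 : (wronskianNum m).eval 1 = -(m * (m + 1)) * (cofactorPoly m).eval 1 := by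
    simp [wronskianNum, Epoly, Fnum₂, Fnum₁, zpowDeriv]
    ring
  have hpos := cofactorPoly_eval_one_pos hm
  have hm' : (0 : ℝ) < m := by exact_mod_cast hm
  have h3 : (wronskianNum m).coeff 1 ≠ 0 := by
    rw [← h1, h2]
    exact mul_ne_zero (neg_ne_zero.2 (by positivity)) hpos.ne'
  rw [h]
  simpa using ⟨h3, ht⟩

lemma Efun_eq_eval (m : ℕ) (t : ℝ) : Efun m t = (Epoly m).eval t := by
  simp only [Efun, Epoly, cofactorPoly, eval_mul, eval_sub, eval_X, eval_one, eval_finsetSum,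
    eval_C, eval_pow]
  congr 1
  refine Finset.sum_bij' (fun k _ => k - 1) (fun k _ => k + 1) ?_ ?_ ?_ ?_ ?_
  · intro k hk; simp at hk ⊢; omega
  · intro k hk; simp at hk ⊢; omega
  · intro k hk; simp at hk ⊢; omega
  · intro k hk; simp
  · intro k hk
    rw [Nat.sub_add_cancel (Finset.mem_Icc.1 hk).1]

end PolynomialIdentities

section Derivatives

open Polynomial

lemma hasDerivAt_eval_mul_zpow (P : ℝ[X]) (a b : ℤ) {t : ℝ} (h0 : t ≠ 0) (h1 : t - 1 ≠ 0) :
    HasDerivAt (fun t : ℝ => P.eval t * t ^ a * (t - 1) ^ b)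
      ((zpowDeriv a b P).eval t * t ^ (a - 1) * (t - 1) ^ (b - 1)) t := by
  have hb : HasDerivAt (fun t : ℝ => (t - 1) ^ b) (b * (t - 1) ^ (b - 1) * 1) t :=
    HasDerivAt.comp t (h₂ := fun t : ℝ => t ^ b) (hasDerivAt_zpow b (t - 1) (Or.inl h1))
      ((hasDerivAt_id t).sub_const 1)
  refine (((P.hasDerivAt t).mul (hasDerivAt_zpow a t (Or.inl h0))).mul hb).congr_deriv ?_
  have ea : t ^ a = t ^ (a - 1) * t := by rw [← zpow_add_one₀ h0]; simp
  have eb : (t - 1) ^ b = (t - 1) ^ (b - 1) * (t - 1) := by rw [← zpow_add_one₀ h1]; simp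
  simp [zpowDeriv]
  rw [ea, eb]
  ring

lemma Ffun_eq_eval_mul_zpow {m : ℕ} (hm : 1 ≤ m) (t : ℝ) :
    Ffun m t = (X - 2 : ℝ[X]).eval t * t ^ (2 * m - 1 : ℤ) * (t - 1) ^ (-m : ℤ) := by
  have : (2 * m - 1 : ℤ) = ((2 * m - 1 : ℕ) : ℤ) := by omega
  rw [this, zpow_natCast, zpow_neg, zpow_natCast, Ffun, div_eq_mul_inv]
  simp

lemma HasDerivAt.comp_div_const {f : ℝ → ℝ} {f' c x : ℝ} (h : HasDerivAt f f' (x / c)) :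
    HasDerivAt (fun x => f (x / c)) (f' / c) x := by
  simpa [div_eq_mul_inv, Function.comp_def] using h.comp x ((hasDerivAt_id x).div_const c)

lemma deriv_eq_of_eqOn_isOpen {s : Set ℝ} (hs : IsOpen s) {f g g' : ℝ → ℝ}
    (h : ∀ x ∈ s, f x = g x) (hg : ∀ x ∈ s, HasDerivAt g (g' x) x) :
    ∀ x ∈ s, deriv f x = g' x := fun x hx =>
  ((hg x hx).congr_of_eventuallyEq (Filter.eventually_of_mem (hs.mem_nhds hx) h)).deriv

end Derivatives

lemma exists_const_of_hasDerivAt_zero {p q : ℝ} (hpq : p < q) {f f' : ℝ → ℝ}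
    (h : ∀ x ∈ Ioo p q, HasDerivAt f (f' x) x) (h' : ∀ x ∈ Ioo p q, f' x = 0) :
    ∃ a, ∀ x ∈ Ioo p q, f x = a := by
  obtain ⟨y, hy⟩ := nonempty_Ioo.2 hpq
  refine ⟨f y, fun x hx => ?_⟩
  exact isOpen_Ioo.is_const_of_deriv_eq_zero isPreconnected_Ioo
    (fun x hx => (h x hx).differentiableAt.differentiableWithinAt)
    (fun x hx => by rw [(h x hx).deriv, h' x hx]; rfl) hx hy

/-- The quotient of two Wronskians of solutions of `A u'' = B u' + C u` is constant. -/
lemma wronskian_div_wronskian_const {p q : ℝ} (hpq : p < q) {A B C : ℝ → ℝ}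
    {u u' u'' v v' v'' e e' e'' f f' f'' : ℝ → ℝ} (hA : ∀ x ∈ Ioo p q, A x ≠ 0)
    (hu : ∀ x ∈ Ioo p q, HasDerivAt u (u' x) x) (hu' : ∀ x ∈ Ioo p q, HasDerivAt u' (u'' x) x)
    (hv : ∀ x ∈ Ioo p q, HasDerivAt v (v' x) x) (hv' : ∀ x ∈ Ioo p q, HasDerivAt v' (v'' x) x)
    (he : ∀ x ∈ Ioo p q, HasDerivAt e (e' x) x) (he' : ∀ x ∈ Ioo p q, HasDerivAt e' (e'' x) x)
    (hf : ∀ x ∈ Ioo p q, HasDerivAt f (f' x) x) (hf' : ∀ x ∈ Ioo p q, HasDerivAt f' (f'' x) x)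
    (hW : ∀ x ∈ Ioo p q, e x * f' x - e' x * f x ≠ 0)
    (odeU : ∀ x ∈ Ioo p q, A x * u'' x = B x * u' x + C x * u x)
    (odeV : ∀ x ∈ Ioo p q, A x * v'' x = B x * v' x + C x * v x)
    (odeE : ∀ x ∈ Ioo p q, A x * e'' x = B x * e' x + C x * e x)
    (odeF : ∀ x ∈ Ioo p q, A x * f'' x = B x * f' x + C x * f x) :
    ∃ k, ∀ x ∈ Ioo p q, (u x * v' x - u' x * v x) / (e x * f' x - e' x * f x) = k := by
  refine exists_const_of_hasDerivAt_zero hpq (fun x hx =>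
    (((hu x hx).mul (hv' x hx)).sub ((hu' x hx).mul (hv x hx))).div
      (((he x hx).mul (hf' x hx)).sub ((he' x hx).mul (hf x hx))) (hW x hx)) (fun x hx => ?_)
  refine div_eq_zero_iff.2 (Or.inl ?_)
  have h1 := odeU x hx
  have h2 := odeV x hx
  have h3 := odeE x hx
  have h4 := odeF x hx
  refine (mul_eq_zero.1 (?_ : A x * _ = 0)).resolve_left (hA x hx)
  simp only [Pi.mul_apply, Pi.sub_apply]
  linear_combination (e x * f' x - e' x * f x) * (u x * h2 - v x * h1) -
    (u x * v' x - u' x * v x) * (e x * h4 - f x * h3)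

/-- Two solutions of `A u'' = B u' + C u` with nonvanishing Wronskian span all solutions. -/
lemma exists_linear_combination_of_wronskian_ne_zero {p q : ℝ} (hpq : p < q) {A B C : ℝ → ℝ}
    {u u' u'' e e' e'' f f' f'' : ℝ → ℝ} (hA : ∀ x ∈ Ioo p q, A x ≠ 0)
    (hu : ∀ x ∈ Ioo p q, HasDerivAt u (u' x) x) (hu' : ∀ x ∈ Ioo p q, HasDerivAt u' (u'' x) x)
    (he : ∀ x ∈ Ioo p q, HasDerivAt e (e' x) x) (he' : ∀ x ∈ Ioo p q, HasDerivAt e' (e'' x) x)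
    (hf : ∀ x ∈ Ioo p q, HasDerivAt f (f' x) x) (hf' : ∀ x ∈ Ioo p q, HasDerivAt f' (f'' x) x)
    (hW : ∀ x ∈ Ioo p q, e x * f' x - e' x * f x ≠ 0)
    (odeU : ∀ x ∈ Ioo p q, A x * u'' x = B x * u' x + C x * u x)
    (odeE : ∀ x ∈ Ioo p q, A x * e'' x = B x * e' x + C x * e x)
    (odeF : ∀ x ∈ Ioo p q, A x * f'' x = B x * f' x + C x * f x) :
    ∃ b d, ∀ x ∈ Ioo p q, u x = b * e x + d * f x := by
  obtain ⟨b, hb⟩ := wronskian_div_wronskian_const hpq hA hu hu' hf hf' he he' hf hf' hW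
    odeU odeF odeE odeF
  obtain ⟨d, hd⟩ := wronskian_div_wronskian_const hpq hA he he' hu hu' he he' hf hf' hW
    odeE odeU odeE odeF
  refine ⟨b, d, fun x hx => ?_⟩
  have hw := hW x hx
  rw [← hb x hx, ← hd x hx, div_mul_eq_mul_div, div_mul_eq_mul_div, ← add_div, eq_div_iff hw]
  ring

open Polynomial in
lemma linearIndependent_one_Efun_Ffun {m : ℕ} (hm : 1 ≤ m) {s : Set ℝ} (hs : s.Infinite)
    (h1 : (1 : ℝ) ∉ s) {a b d : ℝ} (h : ∀ t ∈ s, a + b * Efun m t + d * Ffun m t = 0) :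
    a = 0 ∧ b = 0 ∧ d = 0 := by
  have hpos := cofactorPoly_eval_one_pos hm
  have hz : (C a + C b * Epoly m) * (X - 1) ^ m + C d * ((X - 2) * X ^ (2 * m - 1)) = 0 := by
    refine eq_zero_of_infinite_isRoot _ (hs.mono fun t ht => ?_)
    have ht1 : t - 1 ≠ 0 := sub_ne_zero.2 fun e => h1 (e ▸ ht)
    have := h t ht
    rw [Efun_eq_eval, Ffun] at this
    field_simp at this
    simp [IsRoot.def]
    linear_combination this
  have hd : d = 0 := by
    have := congrArg (eval 1) hz
    simpa [Epoly, show m ≠ 0 by omega, sub_eq_zero] using this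
  subst hd
  have hz' : C a + C b * Epoly m = 0 := by
    have hX : (X - 1 : ℝ[X]) ^ m ≠ 0 := pow_ne_zero _ (X_sub_C_ne_zero 1)
    simpa [hX] using hz
  have ha : a = 0 := by
    have := congrArg (eval 1) hz'
    simpa [Epoly] using this
  subst ha
  have hb : b = 0 := by
    have := congrArg (fun P => eval 1 (derivative P)) hz'
    simpa [Epoly, hpos.ne'] using this
  exact ⟨rfl, hb, rfl⟩

/-- Lemma 21.2. On an open interval containing neither `0` nor `c ≠ 0`,
the `C³` solutions of (20.2) are exactly the combinations of `1`, `E(φ/c)` and `F(φ/c)`,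
and these three functions are linearly independent on the interval. -/
theorem stmt_12 (m : ℕ) (hm : 1 ≤ m) (c : ℝ) (hc : c ≠ 0) (p q : ℝ) (hpq : p < q)
    (h0 : (0 : ℝ) ∉ Ioo p q) (hcI : c ∉ Ioo p q) :
    (∀ σ : ℝ → ℝ, ContDiffOn ℝ 3 σ (Ioo p q) →
      ((∀ x ∈ Ioo p q,
          x ^ 2 * (x - c) * deriv (deriv (deriv σ)) x =
            (((m : ℝ) - 4) * x ^ 2 - 2 * ((m : ℝ) - 1) * c * x) * deriv (deriv σ) x +
              2 * ((m : ℝ) - 1) * (x + c) * deriv σ x) ↔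
        (∃ a b d : ℝ, ∀ x ∈ Ioo p q,
          σ x = a + b * Efun m (x / c) + d * Ffun m (x / c)))) ∧
    (∀ a b d : ℝ,
      (∀ x ∈ Ioo p q, a + b * Efun m (x / c) + d * Ffun m (x / c) = 0) →
      a = 0 ∧ b = 0 ∧ d = 0) := by
  have hI : ∀ x ∈ Ioo p q, x ≠ 0 ∧ x - c ≠ 0 ∧ x / c ≠ 0 ∧ x / c - 1 ≠ 0 := by
    intro x hx
    have hx0 : x ≠ 0 := fun e => h0 (e ▸ hx)
    have hxc : x - c ≠ 0 := sub_ne_zero.2 fun e => hcI (e ▸ hx)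
    refine ⟨hx0, hxc, div_ne_zero hx0 hc, ?_⟩
    rw [div_sub_one hc]
    exact div_ne_zero hxc hc
  let e : ℝ → ℝ := fun x => Efun m (x / c)
  let e₁ : ℝ → ℝ := fun x => (Polynomial.derivative (Epoly m)).eval (x / c) / c
  let e₂ : ℝ → ℝ := fun x =>
    (Polynomial.derivative (Polynomial.derivative (Epoly m))).eval (x / c) / c / c
  let e₃ : ℝ → ℝ := fun x => (Polynomial.derivative (Polynomial.derivative
    (Polynomial.derivative (Epoly m)))).eval (x / c) / c / c / c
  let f : ℝ → ℝ := fun x => Ffun m (x / c)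
  let f₁ : ℝ → ℝ := fun x =>
    (Fnum₁ m).eval (x / c) * (x / c) ^ (2 * m - 2 : ℤ) * (x / c - 1) ^ (-m - 1 : ℤ) / c
  let f₂ : ℝ → ℝ := fun x =>
    (Fnum₂ m).eval (x / c) * (x / c) ^ (2 * m - 3 : ℤ) * (x / c - 1) ^ (-m - 2 : ℤ) / c / c
  let f₃ : ℝ → ℝ := fun x =>
    (Fnum₃ m).eval (x / c) * (x / c) ^ (2 * m - 4 : ℤ) * (x / c - 1) ^ (-m - 3 : ℤ) / c / c / c
  have he : ∀ x ∈ Ioo p q, HasDerivAt e (e₁ x) x := fun x _ => by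
    simp only [e, e₁, Efun_eq_eval]
    exact ((Epoly m).hasDerivAt (x / c)).comp_div_const
  have he₁ : ∀ x ∈ Ioo p q, HasDerivAt e₁ (e₂ x) x := fun x _ =>
    ((Polynomial.hasDerivAt _ (x / c)).comp_div_const).div_const c
  have he₂ : ∀ x ∈ Ioo p q, HasDerivAt e₂ (e₃ x) x := fun x _ =>
    (((Polynomial.hasDerivAt _ (x / c)).comp_div_const).div_const c).div_const c
  have hf : ∀ x ∈ Ioo p q, HasDerivAt f (f₁ x) x := fun x hx => by
    have := hasDerivAt_eval_mul_zpow (Polynomial.X - 2) (2 * m - 1) (-m)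
      (hI x hx).2.2.1 (hI x hx).2.2.2
    simp only [f, Ffun_eq_eval_mul_zpow hm]
    refine (this.comp_div_const).congr_deriv ?_
    simp only [f₁, Fnum₁]
    ring_nf
  have hf₁ : ∀ x ∈ Ioo p q, HasDerivAt f₁ (f₂ x) x := fun x hx => by
    have := hasDerivAt_eval_mul_zpow (Fnum₁ m) (2 * m - 2) (-m - 1)
      (hI x hx).2.2.1 (hI x hx).2.2.2
    refine (this.comp_div_const.div_const c).congr_deriv ?_
    simp only [f₂, Fnum₂]
    ring_nf
  have hf₂ : ∀ x ∈ Ioo p q, HasDerivAt f₂ (f₃ x) x := fun x hx => by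
    have := hasDerivAt_eval_mul_zpow (Fnum₂ m) (2 * m - 3) (-m - 2)
      (hI x hx).2.2.1 (hI x hx).2.2.2
    refine ((this.comp_div_const.div_const c).div_const c).congr_deriv ?_
    simp only [f₃, Fnum₃]
    ring_nf
  have odeE : ∀ x ∈ Ioo p q, x ^ 2 * (x - c) * e₃ x =
      (((m : ℝ) - 4) * x ^ 2 - 2 * ((m : ℝ) - 1) * c * x) * e₂ x +
        2 * ((m : ℝ) - 1) * (x + c) * e₁ x := fun x _ => by
    have h := congrArg (Polynomial.eval (x / c)) (Epoly_ode m)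
    simp only [e₁, e₂, e₃]
    obtain ⟨t, rfl⟩ : ∃ t, x = t * c := ⟨x / c, by field_simp⟩
    rw [mul_div_cancel_right₀ _ hc] at *
    simp at h
    field_simp
    linear_combination h
  have odeF : ∀ x ∈ Ioo p q, x ^ 2 * (x - c) * f₃ x =
      (((m : ℝ) - 4) * x ^ 2 - 2 * ((m : ℝ) - 1) * c * x) * f₂ x +
        2 * ((m : ℝ) - 1) * (x + c) * f₁ x := fun x hx => by
    have h := congrArg (Polynomial.eval (x / c)) (Fnum_ode m)
    obtain ⟨-, -, ht, ht1⟩ := hI x hx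
    simp only [f₁, f₂, f₃]
    have a3 : (2 * m - 3 : ℤ) = 2 * m - 4 + 1 := by ring
    have a2 : (2 * m - 2 : ℤ) = 2 * m - 4 + 1 + 1 := by ring
    have b2 : (-m - 2 : ℤ) = -m - 3 + 1 := by ring
    have b1 : (-m - 1 : ℤ) = -m - 3 + 1 + 1 := by ring
    rw [a3, a2, b2, b1]
    simp only [zpow_add_one₀ ht, zpow_add_one₀ ht1]
    obtain ⟨t, rfl⟩ : ∃ t, x = t * c := ⟨x / c, by field_simp⟩
    rw [mul_div_cancel_right₀ _ hc] at *
    simp at h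
    generalize t ^ (2 * m - 4 : ℤ) = u
    generalize (t - 1) ^ (-m - 3 : ℤ) = v
    field_simp
    linear_combination u * v * h
  have hW : ∀ x ∈ Ioo p q, e₁ x * f₂ x - e₂ x * f₁ x ≠ 0 := fun x hx => by
    obtain ⟨-, -, ht, ht1⟩ := hI x hx
    have key : e₁ x * f₂ x - e₂ x * f₁ x = (wronskianNum m).eval (x / c) *
        (x / c) ^ (2 * m - 3 : ℤ) * (x / c - 1) ^ (-m - 2 : ℤ) / c / c / c := by
      have a2 : (2 * m - 2 : ℤ) = 2 * m - 3 + 1 := by ring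
      have b1 : (-m - 1 : ℤ) = -m - 2 + 1 := by ring
      simp only [e₁, e₂, f₁, f₂, wronskianNum, a2, b1, zpow_add_one₀ ht, zpow_add_one₀ ht1]
      simp
      ring
    rw [key]
    exact div_ne_zero (div_ne_zero (div_ne_zero (mul_ne_zero (mul_ne_zero
      (wronskianNum_eval_ne_zero hm ht) (zpow_ne_zero _ ht)) (zpow_ne_zero _ ht1)) hc) hc) hc
  refine ⟨fun σ hσ => ⟨fun hode => ?_, ?_⟩, fun a b d h => ?_⟩
  · have hσ3 : ContDiffOn ℝ (2 + 1) σ (Ioo p q) := hσ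
    have hd0 := (contDiffOn_succ_iff_deriv_of_isOpen isOpen_Ioo).1 hσ3
    have hσ2 : ContDiffOn ℝ (1 + 1) (deriv σ) (Ioo p q) := by
      simpa [one_add_one_eq_two] using hd0.2.2
    have hd1 := (contDiffOn_succ_iff_deriv_of_isOpen isOpen_Ioo).1 hσ2
    have hs : ∀ {g : ℝ → ℝ}, DifferentiableOn ℝ g (Ioo p q) →
        ∀ x ∈ Ioo p q, HasDerivAt g (deriv g x) x := fun hg x hx =>
      (hg.differentiableAt (isOpen_Ioo.mem_nhds hx)).hasDerivAt
    obtain ⟨b, d, hbd⟩ := exists_linear_combination_of_wronskian_ne_zero hpq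
      (A := fun x => x ^ 2 * (x - c))
      (B := fun x => ((m : ℝ) - 4) * x ^ 2 - 2 * ((m : ℝ) - 1) * c * x)
      (C := fun x => 2 * ((m : ℝ) - 1) * (x + c))
      (fun x hx => mul_ne_zero (pow_ne_zero 2 (hI x hx).1) (hI x hx).2.1)
      (hs hd1.1) (hs (hd1.2.2.differentiableOn one_ne_zero)) he₁ he₂ hf₁ hf₂ hW hode odeE odeF
    obtain ⟨a, ha⟩ := exists_const_of_hasDerivAt_zero hpq
      (fun x hx => ((hs hd0.1 x hx).sub ((he x hx).const_mul b)).sub ((hf x hx).const_mul d))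
      (fun x hx => by rw [hbd x hx]; ring)
    refine ⟨a, b, d, fun x hx => ?_⟩
    rw [← ha x hx]
    simp [e, f]
    ring
  · rintro ⟨a, b, d, h⟩ x hx
    have h1 := deriv_eq_of_eqOn_isOpen isOpen_Ioo h fun x hx =>
      (((he x hx).const_mul b).const_add a).add ((hf x hx).const_mul d)
    have h2 := deriv_eq_of_eqOn_isOpen isOpen_Ioo h1 fun x hx =>
      ((he₁ x hx).const_mul b).add ((hf₁ x hx).const_mul d)
    have h3 := deriv_eq_of_eqOn_isOpen isOpen_Ioo h2 fun x hx =>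
      ((he₂ x hx).const_mul b).add ((hf₂ x hx).const_mul d)
    rw [h1 x hx, h2 x hx, h3 x hx]
    linear_combination b * odeE x hx + d * odeF x hx
  · refine linearIndependent_one_Efun_Ffun hm (s := (fun x => x / c) '' Ioo p q)
      ((Ioo_infinite hpq).image (fun x _ y _ h => (div_left_inj' hc).1 h)) ?_ ?_
    · rintro ⟨x, hx, hx1⟩
      exact (hI x hx).2.2.2 (sub_eq_zero.2 hx1)
    · rintro _ ⟨x, hx, rfl⟩
      exact h x hx
end

section
/- Fix an integer m ≥ 1. Let P be the polynomial P(x) = 1 + 2m·∑_{k=1}^{m} (−1)^{k−1}·binom(m−1, k−1)·x^{2k}/((2k)(2k−1)). Then for every real t ∉ {0, 1}, setting x = (2−t)/t: (1−x²)^m·F(t) = −4^m·x, and 2(1−2m)·E(0)·P(x) = (1−x²)^m·(2E(t) − F(t)). -/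
open Set

/-- The even polynomial `P` of §26, with `P(0) = 1` and `P'' = 2m(1−x²)^{m−1}`. -/
noncomputable def Pfun (m : ℕ) : ℝ → ℝ := fun x =>
  1 + 2 * (m : ℝ) * ∑ k ∈ Finset.Icc 1 m,
    (-1 : ℝ) ^ (k - 1) * ((m - 1).choose (k - 1) : ℝ) * x ^ (2 * k) /
      ((2 * (k : ℝ)) * (2 * (k : ℝ) - 1))

lemma hasDerivAt_one_sub_pow (k : ℕ) (u : ℝ) :
    HasDerivAt (fun u : ℝ => (1 - u) ^ (k + 1)) (-((k + 1 : ℝ) * (1 - u) ^ k)) u :=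
  (((hasDerivAt_id u).const_sub 1).pow (k + 1)).congr_deriv (by simp)

/-- Truncations of the power series of `(1 - u)^(-(m + 1))`, multiplied by `(1 - u)^(m + 1)`,
have a monomial derivative in `u` and `1 - u`. -/
lemma hasDerivAt_one_sub_pow_mul_sum_choose (m N : ℕ) (u : ℝ) :
    HasDerivAt (fun u : ℝ => (1 - u) ^ (m + 1) *
        ∑ j ∈ Finset.range (N + 1), ((m + j).choose j : ℝ) * u ^ j)
      (-((m + N + 1 : ℝ) * ((m + N).choose N : ℝ) * u ^ N * (1 - u) ^ m)) u := by
  have h1 := hasDerivAt_one_sub_pow m u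
  induction N with
  | zero => simpa using h1
  | succ N ih =>
    have hc : ((m + (N + 1)).choose (N + 1) : ℝ) * (N + 1) = (m + N + 1) * (m + N).choose N := by
      have := Nat.add_one_mul_choose_eq (m + N) N
      rw [← add_assoc]
      exact_mod_cast this.symm
    have h2 := ih.add ((h1.mul (hasDerivAt_pow (N + 1) u)).const_mul
      ((m + (N + 1)).choose (N + 1) : ℝ))
    refine (h2.congr_deriv ?_).congr_of_eventuallyEq (Filter.Eventually.of_forall fun v => ?_)
    · simp only [Nat.add_sub_cancel]
      push_cast
      linear_combination (u ^ N * (1 - u) ^ m) * hc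
    · simp only [Pi.add_apply, Pi.mul_apply]
      rw [Finset.sum_range_succ _ (N + 1)]
      ring

/-- The ballot numbers `(m - j)/m · binom(m + j - 1, j)`, with `m = n + 1`, have partial
generating functions expressible through those of `binom(m + j, j)`. -/
lemma sum_ballot_mul_pow (n N : ℕ) (u : ℝ) :
    ∑ j ∈ Finset.range (N + 1), ((n + 1 - j : ℝ) / (n + 1)) * ((n + j).choose n : ℝ) * u ^ j =
      (1 - 2 * u) * ∑ j ∈ Finset.range (N + 1), ((n + 1 + j).choose j : ℝ) * u ^ j +
        2 * ((n + 1 + N).choose N : ℝ) * u ^ (N + 1) := by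
  induction N with
  | zero =>
    have : (n + 1 : ℝ) ≠ 0 := by positivity
    simp [this]
  | succ N ih =>
    rw [Finset.sum_range_succ, ih, Finset.sum_range_succ _ (N + 1)]
    have h1 : ((n + (N + 1)).choose n : ℝ) * (N + 1) = (n + 1 + N).choose N * (n + 1) := by
      have := Nat.choose_succ_right_eq (n + 1 + N) N
      rw [show n + 1 + N - N = n + 1 by omega] at this
      rw [show n + (N + 1) = n + 1 + N by ring,
        Nat.choose_symm_of_eq_add (show n + 1 + N = n + (N + 1) by ring)]
      exact_mod_cast this
    have h2 : ((n + 1 + (N + 1)).choose (N + 1) : ℝ) =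
        (n + 1 + N).choose N + (n + (N + 1)).choose n := by
      rw [show n + 1 + (N + 1) = n + 1 + N + 1 by ring, Nat.choose_succ_succ',
        show n + (N + 1) = n + 1 + N by ring,
        Nat.choose_symm_of_eq_add (show n + 1 + N = n + (N + 1) by ring)]
      push_cast
      ring
    have h3 : ((n + 1 - ((N + 1 : ℕ) : ℝ)) / (n + 1)) * ((n + (N + 1)).choose n : ℝ) =
        (n + (N + 1)).choose n - (n + 1 + N).choose N := by
      have : (n + 1 : ℝ) ≠ 0 := by positivity
      field_simp
      push_cast
      linear_combination -h1
    rw [h3, h2]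
    ring

lemma Pfun_succ (n : ℕ) (x : ℝ) :
    Pfun (n + 1) x = 1 + 2 * (n + 1 : ℝ) * ∑ j ∈ Finset.range (n + 1),
      (-1 : ℝ) ^ j * (n.choose j : ℝ) * (x ^ (2 * j + 2) / ((2 * j + 2) * (2 * j + 1))) := by
  unfold Pfun
  rw [← Finset.Ico_add_one_right_eq_Icc, Finset.sum_Ico_eq_sum_range]
  push_cast
  congr 2
  refine Finset.sum_congr rfl fun j _ => ?_
  simp only [add_tsub_cancel_left]
  rw [mul_div_assoc]
  congr 2 <;> ring

lemma Pfun_neg (m : ℕ) (x : ℝ) : Pfun m (-x) = Pfun m x := by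
  unfold Pfun
  simp only [pow_mul, neg_sq]

lemma Pfun_zero (n : ℕ) : Pfun (n + 1) 0 = 1 := by
  simp [Pfun_succ]

/-- The first derivative of `Pfun (n + 1)`. -/
noncomputable def PfunDeriv (n : ℕ) (x : ℝ) : ℝ :=
  2 * (n + 1 : ℝ) * ∑ j ∈ Finset.range (n + 1),
    (-1 : ℝ) ^ j * (n.choose j : ℝ) * (x ^ (2 * j + 1) / (2 * j + 1))

lemma hasDerivAt_Pfun (n : ℕ) (x : ℝ) :
    HasDerivAt (Pfun (n + 1)) (PfunDeriv n x) x := by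
  rw [funext (Pfun_succ n)]
  refine (HasDerivAt.const_mul _ (HasDerivAt.fun_sum fun j _ => ?_)).const_add 1
  refine HasDerivAt.const_mul _ ?_
  refine ((hasDerivAt_pow (2 * j + 2) x).div_const _).congr_deriv ?_
  have h1 : (2 * j + 2 : ℝ) ≠ 0 := by positivity
  have h2 : (2 * j + 1 : ℝ) ≠ 0 := by positivity
  push_cast
  field_simp

lemma hasDerivAt_PfunDeriv (n : ℕ) (x : ℝ) :
    HasDerivAt (PfunDeriv n) (2 * (n + 1 : ℝ) * (1 - x ^ 2) ^ n) x := by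
  have h : (1 - x ^ 2) ^ n =
      ∑ j ∈ Finset.range (n + 1), (-1 : ℝ) ^ j * (n.choose j : ℝ) * x ^ (2 * j) := by
    rw [sub_eq_neg_add, add_pow]
    refine Finset.sum_congr rfl fun j _ => ?_
    rw [neg_pow, pow_mul]
    ring
  rw [h]
  refine HasDerivAt.const_mul _ (HasDerivAt.fun_sum fun j _ => ?_)
  refine HasDerivAt.const_mul _ ?_
  refine ((hasDerivAt_pow (2 * j + 1) x).div_const _).congr_deriv ?_
  have h2 : (2 * j + 1 : ℝ) ≠ 0 := by positivity
  push_cast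
  field_simp

/-- A real function with vanishing second derivative, agreeing with zero at `1 / 2` and taking
equal values at `0` and `1`, vanishes. -/
lemma eq_zero_of_second_deriv_eq_zero {f f' : ℝ → ℝ} (hf : ∀ u, HasDerivAt f (f' u) u)
    (hf' : ∀ u, HasDerivAt f' 0 u) (h01 : f 0 = f 1) (hhalf : f (1 / 2) = 0) (u : ℝ) :
    f u = 0 := by
  have hconst : ∀ v, f' v = f' 0 := fun v =>
    is_const_of_deriv_eq_zero (fun w => (hf' w).differentiableAt) (fun w => (hf' w).deriv) v 0
  have hlin : ∀ v, HasDerivAt (fun w => f w - f' 0 * w) 0 v := fun v =>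
    ((hf v).sub ((hasDerivAt_id v).const_mul (f' 0))).congr_deriv (by rw [hconst v]; simp)
  have haff : ∀ v, f v - f' 0 * v = f 0 - f' 0 * 0 := fun v =>
    is_const_of_deriv_eq_zero (fun w => (hlin w).differentiableAt) (fun w => (hlin w).deriv) v 0
  have h1 := haff 1
  have h2 := haff (1 / 2)
  have h3 := haff u
  have hs : f' 0 = 0 := by linarith
  rw [hs] at h2 h3
  linarith

lemma two_mul_one_sub_pow_mul_sum_ballot (n : ℕ) (u : ℝ) :
    2 * ((1 - u) ^ (n + 2) * ∑ j ∈ Finset.range (n + 1),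
        ((n + 1 - j : ℝ) / (n + 1)) * ((n + j).choose n : ℝ) * u ^ j) + (2 * u - 1) =
      2 * ((n + 1 + n).choose n : ℝ) / 4 ^ (n + 1) * Pfun (n + 1) (2 * u - 1) := by
  set a : ℝ := ((n + 1 + n).choose n : ℝ) with ha
  set B : ℝ → ℝ := fun u => (1 - u) ^ (n + 1 + 1) *
    ∑ j ∈ Finset.range (n + 1), ((n + 1 + j).choose j : ℝ) * u ^ j with hB
  have hBd : ∀ u, HasDerivAt B (-(2 * (n + 1 : ℝ) * a * u ^ n * (1 - u) ^ (n + 1))) u := fun u => by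
    refine (hasDerivAt_one_sub_pow_mul_sum_choose (n + 1) n u).congr_deriv ?_
    push_cast
    ring
  have hpow' : ∀ (k : ℕ) (u : ℝ),
      HasDerivAt (fun u : ℝ => u ^ (k + 1)) ((k + 1 : ℝ) * u ^ k) u := fun k u => by
    simpa using hasDerivAt_pow (k + 1) u
  have hlin : ∀ u : ℝ, HasDerivAt (fun u : ℝ => 2 * u - 1) 2 u := fun u => by
    simpa using ((hasDerivAt_id u).const_mul 2).sub_const 1
  set K : ℝ := 2 * a / 4 ^ (n + 1) with hK
  have hKa : K * 4 ^ (n + 1) = 2 * a := by rw [hK]; field_simp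
  let f : ℝ → ℝ := fun u => 2 * ((1 - 2 * u) * B u + 2 * a * (u ^ (n + 1) * (1 - u) ^ (n + 1 + 1)))
    + (2 * u - 1) - K * Pfun (n + 1) (2 * u - 1)
  let f' : ℝ → ℝ := fun u => 2 * (-2 * B u - 2 * a * (u ^ (n + 1) * (1 - u) ^ (n + 1))) + 2
    - K * (PfunDeriv n (2 * u - 1) * 2)
  have hf : ∀ u, HasDerivAt f (f' u) u := fun u => by
    have h1 : HasDerivAt (fun u : ℝ => 1 - 2 * u) (-2) u := by
      simpa using ((hasDerivAt_id u).const_mul 2).const_sub 1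
    refine ((((((h1.mul (hBd u)).add (((hpow' n u).mul (hasDerivAt_one_sub_pow (n + 1) u)).const_mul (2 * a))).const_mul
      2).add (hlin u)).sub
      (((hasDerivAt_Pfun n (2 * u - 1)).comp u (hlin u)).const_mul K))).congr_deriv ?_
    simp only [f']
    push_cast
    ring
  have hf' : ∀ u, HasDerivAt f' 0 u := fun u => by
    refine ((((((hBd u).const_mul (-2)).sub
      (((hpow' n u).mul (hasDerivAt_one_sub_pow n u)).const_mul (2 * a))).const_mul 2).add_const 2).sub
      ((((hasDerivAt_PfunDeriv n (2 * u - 1)).comp u (hlin u)).mul_const 2).const_mul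
        K)).congr_deriv ?_
    rw [show 1 - (2 * u - 1) ^ 2 = 4 * (u * (1 - u)) by ring, mul_pow, mul_pow]
    linear_combination (-2 * (n + 1) * u ^ n * (1 - u) ^ n) * hKa
  have hS := sum_ballot_mul_pow n n
  have key : ∀ u, f u = 2 * ((1 - u) ^ (n + 2) * ∑ j ∈ Finset.range (n + 1),
      ((n + 1 - j : ℝ) / (n + 1)) * ((n + j).choose n : ℝ) * u ^ j) + (2 * u - 1)
        - K * Pfun (n + 1) (2 * u - 1) := fun u => by
    rw [hS u]
    simp only [f, hB]
    ring
  have h0 : B 0 = 1 := by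
    simp [hB, Finset.sum_range_succ']
  have h01 : f 0 = f 1 := by
    have hP := Pfun_neg (n + 1) 1
    simp only [f, h0]
    have h1 : B 1 = 0 := by simp [hB]
    rw [h1]
    norm_num [hP]
  have hhalf : f (1 / 2) = 0 := by
    have h4 : (4 : ℝ) ^ (n + 1) = 2 ^ (n + 1) * 2 ^ (n + 1) := by
      rw [← mul_pow]
      norm_num
    simp only [f]
    norm_num [Pfun_zero]
    rw [hK, h4, div_pow, pow_succ (1 / 2 : ℝ) (n + 1), div_pow, one_pow]
    field_simp
    ring
  have := eq_zero_of_second_deriv_eq_zero hf hf' h01 hhalf u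
  rw [key] at this
  linarith

lemma Efun_succ (n : ℕ) (t : ℝ) :
    Efun (n + 1) t = (t - 1) * ∑ j ∈ Finset.range (n + 1),
      ((n + 1 - j : ℝ) / (n + 1)) * ((n + j).choose n : ℝ) * t ^ (n - j) := by
  unfold Efun
  rw [← Finset.Ico_add_one_right_eq_Icc, Finset.sum_Ico_eq_sum_range,
    ← Finset.sum_range_reflect]
  congr 1
  refine Finset.sum_congr (by simp) fun j hj => ?_
  have hj : j ≤ n := by simpa [Nat.lt_succ_iff] using hj
  obtain ⟨i, rfl⟩ := Nat.exists_eq_add_of_le hj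
  rw [show j + i + 1 + 1 - 1 - 1 - j = i by omega,
    show 2 * (j + i + 1) - (1 + i) - 1 = j + i + j by omega]
  simp only [add_tsub_cancel_left, Nat.add_sub_cancel]
  push_cast
  congr 3
  ring

lemma one_sub_two_mul_Efun_zero (n : ℕ) :
    (1 - 2 * ((n + 1 : ℕ) : ℝ)) * Efun (n + 1) 0 = ((n + 1 + n).choose n : ℝ) := by
  rw [Efun_succ, Finset.sum_range_succ, Finset.sum_eq_zero fun j hj => by
    rw [zero_pow (by have := Finset.mem_range.1 hj; omega), mul_zero]]
  have h := Nat.add_one_mul_choose_eq (n + n) n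
  have h2 := Nat.choose_succ_right_eq (n + n + 1) n
  rw [show n + n + 1 - n = n + 1 by omega] at h2
  have h3 : (n + n + 1 : ℝ) * (n + n).choose n = (n + n + 1).choose n * (n + 1) := by
    exact_mod_cast h.trans h2
  rw [show n + 1 + n = n + n + 1 by ring]
  have : (n + 1 : ℝ) ≠ 0 := by positivity
  push_cast
  simp only [Nat.sub_self, pow_zero]
  field_simp
  linear_combination h3

lemma one_sub_sq_pow_mul_Ffun (n : ℕ) {t : ℝ} (h0 : t ≠ 0) (h1 : t ≠ 1) :
    (1 - ((2 - t) / t) ^ 2) ^ (n + 1) * Ffun (n + 1) t = -(4 : ℝ) ^ (n + 1) * ((2 - t) / t) := by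
  have h1' : t - 1 ≠ 0 := sub_ne_zero.2 h1
  unfold Ffun
  rw [show 1 - ((2 - t) / t) ^ 2 = 4 * (t - 1) / t ^ 2 by field_simp; ring, div_pow, mul_pow,
    show 2 * (n + 1) - 1 = 2 * n + 1 by omega, ← pow_mul]
  field_simp
  ring

lemma one_sub_sq_pow_mul_Efun (n : ℕ) {t : ℝ} (h0 : t ≠ 0) :
    (1 - ((2 - t) / t) ^ 2) ^ (n + 1) * Efun (n + 1) t =
      4 ^ (n + 1) * ((1 - t⁻¹) ^ (n + 2) * ∑ j ∈ Finset.range (n + 1),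
        ((n + 1 - j : ℝ) / (n + 1)) * ((n + j).choose n : ℝ) * t⁻¹ ^ j) := by
  have hsum : ∑ j ∈ Finset.range (n + 1),
        ((n + 1 - j : ℝ) / (n + 1)) * ((n + j).choose n : ℝ) * t ^ (n - j) =
      t ^ n * ∑ j ∈ Finset.range (n + 1),
        ((n + 1 - j : ℝ) / (n + 1)) * ((n + j).choose n : ℝ) * t⁻¹ ^ j := by
    rw [Finset.mul_sum]
    refine Finset.sum_congr rfl fun j hj => ?_
    rw [pow_sub₀ t h0 (Nat.lt_succ_iff.1 (Finset.mem_range.1 hj)), inv_pow]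
    ring
  rw [Efun_succ, hsum, show 1 - ((2 - t) / t) ^ 2 = 4 * (t - 1) / t ^ 2 by field_simp; ring,
    div_pow, mul_pow, show 1 - t⁻¹ = (t - 1) / t by field_simp, div_pow, ← pow_mul]
  field_simp
  ring

/-- formula (26.1). -/
theorem stmt_14 (m : ℕ) (hm : 1 ≤ m) :
    ∀ t : ℝ, t ≠ 0 → t ≠ 1 →
      (1 - ((2 - t) / t) ^ 2) ^ m * Ffun m t = -(4 : ℝ) ^ m * ((2 - t) / t) ∧
      2 * (1 - 2 * (m : ℝ)) * Efun m 0 * Pfun m ((2 - t) / t) =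
        (1 - ((2 - t) / t) ^ 2) ^ m * (2 * Efun m t - Ffun m t) := by
  obtain ⟨n, rfl⟩ : ∃ n, m = n + 1 := ⟨m - 1, by omega⟩
  intro t h0 h1
  have hF := one_sub_sq_pow_mul_Ffun n h0 h1
  refine ⟨hF, ?_⟩
  have hE := one_sub_sq_pow_mul_Efun n h0
  have hP := two_mul_one_sub_pow_mul_sum_ballot n t⁻¹
  have hx : 2 * t⁻¹ - 1 = (2 - t) / t := by field_simp
  rw [hx] at hP
  have ha := one_sub_two_mul_Efun_zero n
  have h4 : (4 : ℝ) ^ (n + 1) * (2 * ((n + 1 + n).choose n : ℝ) / 4 ^ (n + 1)) =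
      2 * (n + 1 + n).choose n := by field_simp
  linear_combination 2 * Pfun (n + 1) ((2 - t) / t) * ha - 2 * hE + hF - 4 ^ (n + 1) * hP -
    Pfun (n + 1) ((2 - t) / t) * h4
end

section
/- Fix an integer m ≥ 1. Let Q, Y, σ, τ, λ, μ be continuously differentiable (C¹) real-valued functions of φ on an open interval I satisfying the system (10.1) on I, with σ ≠ 0 everywhere on I. Then the function φ ↦ Y(φ) + λ(φ)Q(φ)/σ(φ) is constant on I. -/
open Set

/-- The first integral `Y + λQ/σ` of the system (10.1). -/
theorem stmt_15 (m : ℕ) (hm : 1 ≤ m) (p q : ℝ) (hpq : p < q)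
    (Q Y σ τ lm μ : ℝ → ℝ)
    (hQ : ContDiffOn ℝ 1 Q (Ioo p q)) (hY : ContDiffOn ℝ 1 Y (Ioo p q))
    (hσ : ContDiffOn ℝ 1 σ (Ioo p q)) (hτ : ContDiffOn ℝ 1 τ (Ioo p q))
    (hlm : ContDiffOn ℝ 1 lm (Ioo p q)) (hμ : ContDiffOn ℝ 1 μ (Ioo p q))
    (hsys : Sys101 m (Ioo p q) Q Y σ τ lm μ)
    (hσ0 : ∀ x ∈ Ioo p q, σ x ≠ 0) :
    ∃ k : ℝ, ∀ x ∈ Ioo p q, Y x + lm x * Q x / σ x = k := by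
  have hderiv : ∀ {f : ℝ → ℝ}, ContDiffOn ℝ 1 f (Ioo p q) → ∀ x ∈ Ioo p q,
      HasDerivAt f (deriv f x) x := fun hf x hx =>
    ((hf.differentiableOn one_ne_zero).differentiableAt (isOpen_Ioo.mem_nhds hx)).hasDerivAt
  have hzero : ∀ x ∈ Ioo p q, HasDerivAt (fun x => Y x + lm x * Q x / σ x) 0 x := by
    intro x hx
    obtain ⟨eQ, eY, eσ, -, el⟩ := hsys x hx
    have hs := hσ0 x hx
    have h := (hderiv hY x hx).add
      (((hderiv hlm x hx).mul (hderiv hQ x hx)).div (hderiv hσ x hx) hs)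
    refine h.congr_deriv ?_
    simp only [Pi.mul_apply]
    rw [eY, eQ]
    field_simp
    linear_combination σ x * el - lm x * eσ
  exact isOpen_Ioo.exists_is_const_of_deriv_eq_zero isPreconnected_Ioo
    (fun x hx => (hzero x hx).differentiableAt.differentiableWithinAt)
    (fun x hx => (hzero x hx).deriv)
end

section
/- Fix an integer m ≥ 2. Let Q, Y, s, σ, τ, λ, μ be continuously differentiable (C¹) real-valued functions of φ on an open interval I satisfying the system (10.1) and the equations (10.2) on I, with Q ≠ 0 everywhere on I and λ(φ) ≠ μ(φ) for every φ ∈ I. Set Z = 2(m−1)(τ−σ)/(λ−μ). Then the function φ ↦ (μ + (m−1)λ)Z² + 2(2m−1)(τ + (m−1)σ)Z − m(2m−1)Q is constant on I. -/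
open Set

/-- The quotient `Z = 2(m−1)(τ−σ)/(λ−μ)` has derivative `1`. -/
theorem hasDerivAt_quotient {c x w σ' τ' l' u' : ℝ} {σ τ l u : ℝ → ℝ}
    (hσ : HasDerivAt σ σ' x) (hτ : HasDerivAt τ τ' x)
    (hl : HasDerivAt l l' x) (hu : HasDerivAt u u' x)
    (hQ : w ≠ 0) (hne : l x ≠ u x)
    (eσ : w * σ' = 2 * (τ x - σ x) * σ x)
    (eτ : w * τ' = 2 * (c - 1) * (σ x - τ x) * σ x - u x * w)
    (el : w * l' = 2 * (u x - l x) * σ x)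
    (eu : 2 * (c - 1) * (τ x - σ x) * w * u' =
      (l x - u x) * (l x * w + (2 * c - 3) * u x * w +
        4 * (c - 1) ^ 2 * (τ x - σ x) * σ x)) :
    HasDerivAt (fun y => 2 * (c - 1) * (τ y - σ y) / (l y - u y)) 1 x := by
  have he : l x - u x ≠ 0 := sub_ne_zero.mpr hne
  refine (((hτ.sub hσ).const_mul (2 * (c - 1))).div (hl.sub hu) he).congr_deriv ?_
  simp only [Pi.sub_apply]
  rw [div_eq_iff (pow_ne_zero 2 he)]
  refine mul_left_cancel₀ hQ ?_
  linear_combination 2 * (c - 1) * (l x - u x) * (eτ - eσ) -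
    2 * (c - 1) * (τ x - σ x) * el + eu

/-- The first integral
`(μ + (m−1)λ)Z² + 2(2m−1)(τ + (m−1)σ)Z − m(2m−1)Q`, where
`Z = 2(m−1)(τ−σ)/(λ−μ)`. -/
theorem stmt_16 (m : ℕ) (hm : 2 ≤ m) (p q : ℝ) (hpq : p < q)
    (Q Y s σ τ lm μ : ℝ → ℝ)
    (hQ : ContDiffOn ℝ 1 Q (Ioo p q)) (hY : ContDiffOn ℝ 1 Y (Ioo p q))
    (hs : ContDiffOn ℝ 1 s (Ioo p q)) (hσ : ContDiffOn ℝ 1 σ (Ioo p q))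
    (hτ : ContDiffOn ℝ 1 τ (Ioo p q)) (hlm : ContDiffOn ℝ 1 lm (Ioo p q))
    (hμ : ContDiffOn ℝ 1 μ (Ioo p q))
    (hsys : Sys101 m (Ioo p q) Q Y σ τ lm μ)
    (heqs : Eqs102 m (Ioo p q) Q s σ τ lm μ)
    (hQ0 : ∀ x ∈ Ioo p q, Q x ≠ 0)
    (hlmμ : ∀ x ∈ Ioo p q, lm x ≠ μ x) :
    ∃ k : ℝ, ∀ x ∈ Ioo p q,
      (μ x + ((m : ℝ) - 1) * lm x) *
          (2 * ((m : ℝ) - 1) * (τ x - σ x) / (lm x - μ x)) ^ 2 +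
        2 * (2 * (m : ℝ) - 1) * (τ x + ((m : ℝ) - 1) * σ x) *
          (2 * ((m : ℝ) - 1) * (τ x - σ x) / (lm x - μ x)) -
        (m : ℝ) * (2 * (m : ℝ) - 1) * Q x = k := by
  have diff {f : ℝ → ℝ} (hf : ContDiffOn ℝ 1 f (Ioo p q)) {x : ℝ} (hx : x ∈ Ioo p q) :
      HasDerivAt f (deriv f x) x :=
    ((hf.differentiableOn one_ne_zero).differentiableAt (isOpen_Ioo.mem_nhds hx)).hasDerivAt
  have key : ∀ x ∈ Ioo p q, HasDerivAt (fun x => (μ x + ((m : ℝ) - 1) * lm x) *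
          (2 * ((m : ℝ) - 1) * (τ x - σ x) / (lm x - μ x)) ^ 2 +
        2 * (2 * (m : ℝ) - 1) * (τ x + ((m : ℝ) - 1) * σ x) *
          (2 * ((m : ℝ) - 1) * (τ x - σ x) / (lm x - μ x)) -
        (m : ℝ) * (2 * (m : ℝ) - 1) * Q x) 0 x := by
    intro x hx
    obtain ⟨eQ, -, eσ, eτ, el⟩ := hsys x hx
    obtain ⟨eu, -⟩ := heqs x hx
    have he : lm x - μ x ≠ 0 := sub_ne_zero.mpr (hlmμ x hx)
    have hZ := hasDerivAt_quotient (diff hσ hx) (diff hτ hx) (diff hlm hx) (diff hμ hx)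
      (hQ0 x hx) (hlmμ x hx) eσ eτ el eu
    have hZe : 2 * ((m : ℝ) - 1) * (τ x - σ x) / (lm x - μ x) * (lm x - μ x) =
        2 * ((m : ℝ) - 1) * (τ x - σ x) := div_mul_cancel₀ _ he
    refine HasDerivAt.congr_deriv (((((diff hμ hx).add ((diff hlm hx).const_mul ((m : ℝ) - 1))).mul (hZ.pow 2)).add
      ((((diff hτ hx).add ((diff hσ hx).const_mul ((m : ℝ) - 1))).const_mul
        (2 * (2 * (m : ℝ) - 1))).mul hZ)).sub
      ((diff hQ hx).const_mul ((m : ℝ) * (2 * (m : ℝ) - 1)))) ?_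
    simp only [Pi.add_apply, Pi.pow_apply]
    generalize 2 * ((m : ℝ) - 1) * (τ x - σ x) / (lm x - μ x) = Z at hZe ⊢
    have hZμ : Z * Q x * deriv μ x = lm x * Q x + (2 * (m : ℝ) - 3) * μ x * Q x +
        4 * ((m : ℝ) - 1) ^ 2 * (τ x - σ x) * σ x := by
      refine mul_left_cancel₀ he ?_
      linear_combination eu + Q x * deriv μ x * hZe
    refine mul_left_cancel₀ (hQ0 x hx) ?_
    push_cast
    linear_combination Z * hZμ + ((m : ℝ) - 1) * Z ^ 2 * el +
      2 * (2 * (m : ℝ) - 1) * Z * (eτ + ((m : ℝ) - 1) * eσ) -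
      (m : ℝ) * (2 * (m : ℝ) - 1) * Q x * eQ -
      (2 * ((m : ℝ) - 1) * σ x * Z - (2 * (m : ℝ) - 1) * Q x) * hZe
  exact isOpen_Ioo.exists_is_const_of_deriv_eq_zero isPreconnected_Ioo
    (fun x hx => (key x hx).differentiableAt.differentiableWithinAt)
    (fun x hx => (key x hx).deriv)
end

section
/- Fix an integer m ≥ 1 and define E and F as in the context. Then for all real t: −t²(t−1)E''(t) + ((m−1)t − 2m)·t·E'(t) + 2(2m−1)E(t) = 2(2m−1)E(0); and for all real t ≠ 1: −t²(t−1)F''(t) + ((m−1)t − 2m)·t·F'(t) + 2(2m−1)F(t) = 0. -/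
open Set

/-- The coefficient of `t ^ j` in `Efun (n + 2)`. -/
noncomputable def Ecoeff (n j : ℕ) : ℝ :=
  ((j : ℝ) - 1) / ((n : ℝ) + 1) * ((2 * n + 2 - j).choose n : ℝ)

lemma Ecoeff_eq_sub (n j : ℕ) (hj : j ≤ n + 1) :
    Ecoeff n j = (j : ℝ) / ((n : ℝ) + 2) * ((2 * n + 3 - j).choose (n + 1) : ℝ) -
      ((j : ℝ) + 1) / ((n : ℝ) + 2) * ((2 * n + 2 - j).choose (n + 1) : ℝ) := by
  obtain ⟨p, hp⟩ := Nat.exists_eq_add_of_le hj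
  have hp' : (j : ℝ) = n + 1 - p := by
    have : ((n + 1 : ℕ) : ℝ) = ((j + p : ℕ) : ℝ) := by rw [hp]
    push_cast at this
    linarith
  have h1 : 2 * n + 3 - j = (n + 1 + p) + 1 := by omega
  have h2 : 2 * n + 2 - j = n + 1 + p := by omega
  have h3 := Nat.choose_succ_right_eq (n + 1 + p) n
  rw [show n + 1 + p - n = p + 1 by omega] at h3
  have h4 : ((n + 1 + p).choose (n + 1) : ℝ) * (n + 1) = (n + 1 + p).choose n * (p + 1) := by
    exact_mod_cast h3
  have h5 : ((n + 1 + p).choose (n + 1) : ℝ) = (n + 1 + p).choose n * (p + 1) / (n + 1) := by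
    rw [eq_div_iff (by positivity), h4]
  rw [Ecoeff, h1, h2, Nat.choose_succ_succ' (n + 1 + p) n, Nat.cast_add, h5, hp']
  field_simp
  ring

lemma Ecoeff_succ (n j : ℕ) (hj : j ≤ n + 1) :
    Ecoeff n (j + 1) * (((j : ℝ) - 1) * (2 * n + 2 - j)) =
      Ecoeff n j * (j * (n + 2 - j)) := by
  obtain ⟨p, hp⟩ := Nat.exists_eq_add_of_le hj
  have hp' : (j : ℝ) = n + 1 - p := by
    have : ((n + 1 : ℕ) : ℝ) = ((j + p : ℕ) : ℝ) := by rw [hp]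
    push_cast at this
    linarith
  have h1 : 2 * n + 2 - (j + 1) = n + p := by omega
  have h2 : 2 * n + 2 - j = n + p + 1 := by omega
  have h3 := Nat.choose_mul_succ_eq (n + p) n
  rw [show n + p + 1 - n = p + 1 by omega] at h3
  have h4 : ((n + p).choose n : ℝ) * (n + p + 1) = (n + p + 1).choose n * (p + 1) := by
    exact_mod_cast h3
  rw [Ecoeff, Ecoeff, h1, h2]
  push_cast
  rw [hp']
  linear_combination ((n : ℝ) + 1 - p) * (n - p) / (n + 1) * h4

lemma Efun_eq_sum (n : ℕ) :
    Efun (n + 2) = fun t => ∑ j ∈ Finset.range (n + 3), Ecoeff n j * t ^ j := by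
  funext t
  have key : ∀ K ≤ n + 2, (t - 1) * ∑ k ∈ Finset.range K,
      ((k : ℝ) + 1) / ((n : ℝ) + 2) * ((2 * n + 2 - k).choose (n + 1) : ℝ) * t ^ k =
      (∑ j ∈ Finset.range K, Ecoeff n j * t ^ j) +
        (K : ℝ) / ((n : ℝ) + 2) * ((2 * n + 3 - K).choose (n + 1) : ℝ) * t ^ K := by
    intro K hK
    induction K with
    | zero => simp
    | succ K ih =>
      rw [Finset.sum_range_succ, Finset.sum_range_succ, mul_add, ih (by omega),
        Ecoeff_eq_sub n K (by omega), show 2 * n + 3 - (K + 1) = 2 * n + 2 - K by omega]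
      push_cast
      ring
  have hlast : Ecoeff n (n + 2) =
      ((n + 2 : ℕ) : ℝ) / ((n : ℝ) + 2) *
        ((2 * n + 3 - (n + 2)).choose (n + 1) : ℝ) := by
    rw [Ecoeff, show 2 * n + 2 - (n + 2) = n by omega,
      show 2 * n + 3 - (n + 2) = n + 1 by omega, Nat.choose_self, Nat.choose_self]
    push_cast
    field_simp
    ring
  rw [Finset.sum_range_succ, hlast, ← key (n + 2) le_rfl, Efun, ← Finset.Ico_succ_right_eq_Icc,
    Finset.sum_Ico_eq_sum_range]
  congr 1
  refine Finset.sum_congr (by simp) fun k _ => ?_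
  rw [show 2 * (n + 2) - (1 + k) - 1 = 2 * n + 2 - k by omega,
    show n + 2 - 1 = n + 1 by omega, show 1 + k - 1 = k by omega]
  push_cast
  ring

lemma deriv_sum_mul_pow (N : ℕ) (a : ℕ → ℝ) (b : ℕ → ℕ) :
    deriv (fun t : ℝ => ∑ j ∈ Finset.range N, a j * t ^ b j) =
      fun t => ∑ j ∈ Finset.range N, a j * b j * t ^ (b j - 1) := by
  funext t
  refine (HasDerivAt.fun_sum fun j _ => ?_).deriv
  simpa only [mul_assoc] using (hasDerivAt_pow (b j) t).const_mul (a j)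

lemma Efun_ode (n : ℕ) (t : ℝ) :
    -(t ^ 2) * (t - 1) * deriv (deriv (Efun (n + 2))) t +
      (((n : ℝ) + 1) * t - 2 * ((n : ℝ) + 2)) * t * deriv (Efun (n + 2)) t +
      2 * (2 * (n : ℝ) + 3) * Efun (n + 2) t = 2 * (2 * (n : ℝ) + 3) * Efun (n + 2) 0 := by
  have h0 : Efun (n + 2) 0 = Ecoeff n 0 := by
    rw [Efun_eq_sum]
    simp [Finset.sum_range_succ']
  have hterm : ∀ j : ℕ, -(t ^ 2) * (t - 1) *
        (Ecoeff n j * j * ((j - 1 : ℕ) : ℝ) * t ^ (j - 1 - 1)) +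
      (((n : ℝ) + 1) * t - 2 * ((n : ℝ) + 2)) * t * (Ecoeff n j * j * t ^ (j - 1)) +
      2 * (2 * (n : ℝ) + 3) * (Ecoeff n j * t ^ j) =
      Ecoeff n j * (j * (n + 2 - j)) * t ^ (j + 1) +
        Ecoeff n j * (((j : ℝ) - 2) * (j - 2 * n - 3)) * t ^ j := by
    rintro (_ | _ | j)
    · simp
      ring
    · simp
      ring
    · simp only [Nat.add_sub_cancel]
      push_cast
      ring
  have key : ∀ K ≤ n + 2, ∑ j ∈ Finset.range (K + 1),
      (Ecoeff n j * (j * (n + 2 - j)) * t ^ (j + 1) +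
        Ecoeff n j * (((j : ℝ) - 2) * (j - 2 * n - 3)) * t ^ j) =
      2 * (2 * (n : ℝ) + 3) * Ecoeff n 0 + Ecoeff n K * (K * (n + 2 - K)) * t ^ (K + 1) := by
    intro K hK
    induction K with
    | zero =>
      simp
      ring
    | succ K ih =>
      rw [Finset.sum_range_succ, ih (by omega)]
      have h := Ecoeff_succ n K (by omega)
      push_cast
      linear_combination (-t ^ (K + 1)) * h
  rw [h0, Efun_eq_sum, deriv_sum_mul_pow _ _ fun j => j, deriv_sum_mul_pow]
  simp only [Finset.mul_sum]
  rw [← Finset.sum_add_distrib, ← Finset.sum_add_distrib,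
    Finset.sum_congr rfl fun j _ => hterm j, key (n + 2) le_rfl]
  push_cast
  ring

lemma Efun_one : Efun 1 = fun t => t - 1 := by
  funext t
  simp [Efun]

lemma deriv_Ffun (n : ℕ) {t : ℝ} (ht : t ≠ 1) :
    deriv (Ffun (n + 1)) t =
      ((n + 1) * t ^ 2 - (2 * n + 1) * 2 * t + 2 * (2 * n + 1)) * t ^ (2 * n) /
        (t - 1) ^ (n + 2) := by
  have h1 : t - 1 ≠ 0 := sub_ne_zero.mpr ht
  have hF : Ffun (n + 1) = fun t => (t - 2) * t ^ (2 * n + 1) / (t - 1) ^ (n + 1) := rfl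
  have h := ((((hasDerivAt_id' t).sub_const 2).fun_mul (hasDerivAt_pow (2 * n + 1) t)).fun_div
    (((hasDerivAt_id' t).sub_const 1).fun_pow (n + 1)) (pow_ne_zero _ h1)).deriv
  rw [hF, h]
  simp only [Nat.add_sub_cancel]
  push_cast
  field_simp
  ring

lemma Ffun_ode (n : ℕ) {t : ℝ} (ht : t ≠ 1) :
    -(t ^ 2) * (t - 1) * deriv (deriv (Ffun (n + 1))) t +
      ((n : ℝ) * t - 2 * ((n : ℝ) + 1)) * t * deriv (Ffun (n + 1)) t +
      2 * (2 * (n : ℝ) + 1) * Ffun (n + 1) t = 0 := by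
  have h1 : t - 1 ≠ 0 := sub_ne_zero.mpr ht
  have hev : deriv (Ffun (n + 1)) =ᶠ[nhds t] fun t =>
      ((n + 1) * t ^ 2 - (2 * n + 1) * 2 * t + 2 * (2 * n + 1)) * t ^ (2 * n) /
        (t - 1) ^ (n + 2) := by
    filter_upwards [isOpen_ne.mem_nhds ht] with s hs using deriv_Ffun n hs
  have hq : HasDerivAt (fun t : ℝ =>
      ((n : ℝ) + 1) * t ^ 2 - (2 * n + 1) * 2 * t + 2 * (2 * n + 1))
      (((n : ℝ) + 1) * (2 * t) - (2 * n + 1) * 2) t := by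
    simpa using ((((hasDerivAt_pow 2 t).const_mul ((n : ℝ) + 1)).fun_sub
      ((hasDerivAt_id' t).const_mul ((2 * (n : ℝ) + 1) * 2))).add_const (2 * (2 * (n : ℝ) + 1)))
  have h := ((hq.fun_mul (hasDerivAt_pow (2 * n) t)).fun_div
    (((hasDerivAt_id' t).sub_const 1).fun_pow (n + 2)) (pow_ne_zero _ h1)).deriv
  have hpow : ((2 * n : ℕ) : ℝ) * t ^ (2 * n - 1) * t = 2 * n * t ^ (2 * n) := by
    rcases n with _ | n
    · simp
    · rw [mul_assoc, ← pow_succ, show 2 * (n + 1) - 1 + 1 = 2 * (n + 1) by omega]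
      push_cast
      ring
  have hF : Ffun (n + 1) t = (t - 2) * t ^ (2 * n + 1) / (t - 1) ^ (n + 1) := rfl
  rw [hev.deriv_eq, h, deriv_Ffun n ht, hF, show n + 2 - 1 = n + 1 by omega]
  generalize ((2 * n : ℕ) : ℝ) * t ^ (2 * n - 1) = d at hpow
  push_cast
  rw [pow_succ t (2 * n)]
  generalize t ^ (2 * n) = p at hpow
  rw [show n + 2 = n + 1 + 1 by omega, pow_succ (t - 1) (n + 1)]
  have hb : (t - 1) ^ (n + 1) ≠ 0 := pow_ne_zero _ h1
  generalize (t - 1) ^ (n + 1) = b at hb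
  field_simp
  linear_combination (-(t - 1) * t *
    (((n : ℝ) + 1) * t ^ 2 - (2 * n + 1) * 2 * t + 2 * (2 * n + 1))) * hpow

/-- Second-order identities satisfied by `E` and `F`. -/
theorem stmt_17 (m : ℕ) (hm : 1 ≤ m) :
    (∀ t : ℝ,
      -(t ^ 2) * (t - 1) * deriv (deriv (Efun m)) t +
        (((m : ℝ) - 1) * t - 2 * (m : ℝ)) * t * deriv (Efun m) t +
        2 * (2 * (m : ℝ) - 1) * Efun m t = 2 * (2 * (m : ℝ) - 1) * Efun m 0) ∧
    (∀ t : ℝ, t ≠ 1 →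
      -(t ^ 2) * (t - 1) * deriv (deriv (Ffun m)) t +
        (((m : ℝ) - 1) * t - 2 * (m : ℝ)) * t * deriv (Ffun m) t +
        2 * (2 * (m : ℝ) - 1) * Ffun m t = 0) := by
  obtain ⟨n, rfl⟩ := Nat.exists_eq_add_of_le' hm
  refine ⟨fun t => ?_, fun t ht => ?_⟩
  · rcases n with _ | n
    · have hd : deriv (Efun 1) = fun _ => 1 := by
        rw [Efun_one]
        funext s
        simp
      rw [zero_add, hd, Efun_one]
      simp
      ring
    · have h := Efun_ode n t
      push_cast
      linear_combination h
  · have h := Ffun_ode n ht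
    push_cast
    linear_combination h
end

section
/- Fix an integer m ≥ 2. Let Q, Y, s, σ, τ, λ, μ be continuously differentiable (C¹) real-valued functions of φ on an open interval I with 0 ∉ I, satisfying the system (10.1), the equations (10.2) and the constraints (10.3) on I, with σ ≠ 0 everywhere on I, and let c be a real constant with Q = 2(φ−c)σ on I. Then σ is twice differentiable on I and, everywhere on I: Y + λQ/σ = 2(mσ − (φ−c)²σ'' − m(φ−c)σ' + 2(m−1)(φ−c)²σ'/φ). -/
open Set

/-- The integral `Y + λQ/σ` expressed through `σ` and its derivatives. -/
theorem stmt_18 (m : ℕ) (hm : 2 ≤ m) (p q : ℝ) (hpq : p < q)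
    (h0 : (0 : ℝ) ∉ Ioo p q)
    (Q Y s σ τ lm μ : ℝ → ℝ)
    (hQ : ContDiffOn ℝ 1 Q (Ioo p q)) (hY : ContDiffOn ℝ 1 Y (Ioo p q))
    (hs : ContDiffOn ℝ 1 s (Ioo p q)) (hσ : ContDiffOn ℝ 1 σ (Ioo p q))
    (hτ : ContDiffOn ℝ 1 τ (Ioo p q)) (hlm : ContDiffOn ℝ 1 lm (Ioo p q))
    (hμ : ContDiffOn ℝ 1 μ (Ioo p q))
    (hsys : Sys101 m (Ioo p q) Q Y σ τ lm μ)
    (heqs : Eqs102 m (Ioo p q) Q s σ τ lm μ)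
    (hcon : Con103 m (Ioo p q) Q Y s σ τ lm μ)
    (hσ0 : ∀ x ∈ Ioo p q, σ x ≠ 0)
    (c : ℝ) (hc : ∀ x ∈ Ioo p q, Q x = 2 * (x - c) * σ x) :
    ∀ x ∈ Ioo p q,
      DifferentiableAt ℝ σ x ∧ DifferentiableAt ℝ (deriv σ) x ∧
      Y x + lm x * Q x / σ x =
        2 * ((m : ℝ) * σ x - (x - c) ^ 2 * deriv (deriv σ) x -
          (m : ℝ) * (x - c) * deriv σ x +
          2 * ((m : ℝ) - 1) * (x - c) ^ 2 * deriv σ x / x) := by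
  intro x hx
  obtain ⟨hQ0, hYs, hφ⟩ := hcon
  have hnhds : Ioo p q ∈ nhds x := isOpen_Ioo.mem_nhds hx
  have hshift : ∀ y ∈ Ioo p q, y - c ≠ 0 := fun y hy h => hQ0 y hy (by rw [hc y hy, h]; ring)
  have hσ' : ∀ y ∈ Ioo p q, deriv σ y = (τ y - σ y) / (y - c) := by
    intro y hy
    have h := (hsys y hy).2.2.1
    rw [hc y hy] at h
    rw [eq_div_iff (hshift y hy)]
    exact mul_left_cancel₀ (mul_ne_zero two_ne_zero (hσ0 y hy)) (by linear_combination h)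
  have hσd : DifferentiableAt ℝ σ x := (hσ.differentiableOn one_ne_zero).differentiableAt hnhds
  have hτd : DifferentiableAt ℝ τ x := (hτ.differentiableOn one_ne_zero).differentiableAt hnhds
  have hd : x - c ≠ 0 := hshift x hx
  have hx0 : x ≠ 0 := fun h => h0 (h ▸ hx)
  have hev : deriv σ =ᶠ[nhds x] fun y => (τ y - σ y) / (y - c) :=
    Filter.eventually_of_mem hnhds hσ'
  have hquot : HasDerivAt (deriv σ)
      (((deriv τ x - deriv σ x) * (x - c) - (τ x - σ x) * 1) / (x - c) ^ 2) x :=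
    ((hτd.hasDerivAt.sub hσd.hasDerivAt).div ((hasDerivAt_id x).sub_const c) hd).congr_of_eventuallyEq
      hev
  refine ⟨hσd, hquot.differentiableAt, ?_⟩
  have hτσ : τ x - σ x = deriv σ x * (x - c) := by rw [hσ' x hx, div_mul_cancel₀ _ hd]
  have hτ' : deriv τ x = -((m : ℝ) - 1) * deriv σ x - μ x := by
    have h := (hsys x hx).2.2.2.1
    rw [hc x hx] at h
    refine mul_left_cancel₀ (mul_ne_zero (mul_ne_zero two_ne_zero hd) (hσ0 x hx)) ?_
    linear_combination h - 2 * ((m : ℝ) - 1) * σ x * hτσ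
  have hσ'' : (x - c) ^ 2 * deriv (deriv σ) x =
      -((m : ℝ) + 1) * (x - c) * deriv σ x - (x - c) * μ x := by
    rw [hquot.deriv, mul_div_cancel₀ _ (pow_ne_zero 2 hd)]
    linear_combination (x - c) * hτ' - hτσ
  have hlmμ : 2 * ((m : ℝ) - 1) * (x - c) ^ 2 * deriv σ x / x = (x - c) * (lm x - μ x) := by
    rw [div_eq_iff hx0]
    linear_combination (x - c) * hφ x hx - 2 * ((m : ℝ) - 1) * (x - c) * hτσ
  have hlmQ : lm x * Q x / σ x = 2 * (x - c) * lm x := by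
    rw [hc x hx, div_eq_iff (hσ0 x hx)]
    ring
  rw [hlmQ, hlmμ, hσ'', (hYs x hx).1]
  linear_combination 2 * hτσ
end
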